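/- arXiv:math/0511407 — 3 statements merged into one kernel-verified Lean document; each statement's English description precedes it below -/
import Mathlib

section
/- Let K be a field and let A be a reduced commutative K-algebra. Then for every positive integer m (with no restriction relating m to the characteristic of K) and all a, b ∈ A, the equality (y+a)^m = (y+b)^m in the polynomial ring A[y] implies a = b. -/
open Polynomial

/-- Let `K` be a field and `A` a reduced commutative `K`-algebra.  Then for every positive
integer `m` (with no restriction relating `m` to the characteristic of `K`) and all
`a, b ∈ A`, the equality `(y + a)^m = (y + b)^m` in `A[y]` implies `a = b`. -/
theorem pow_linear_eq_imp_eq_of_isReduced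
    (K : Type*) [Field K] (A : Type*) [CommRing A] [Algebra K A] (hred : IsReduced A)
    (m : ℕ) (hm : 0 < m) (a b : A)
    (h : (X + C a) ^ m = (X + C b) ^ m) : a = b := by
  have h_eval := congrArg (eval (-a)) h
  simp only [eval_pow, eval_add, eval_X, eval_C, neg_add_cancel, zero_pow hm.ne'] at h_eval
  exact neg_add_eq_zero.mp (eq_zero_of_pow_eq_zero h_eval.symm)
end

section
/- Let p be a prime number and let A be a commutative ring of characteristic p. Let j ≥ 0 and m̄ ≥ 1 be integers and set m = p^j · m̄. Then for all a, b ∈ A, the coefficient of y^{m − p^j} in the polynomial (y+a)^m − (y+b)^m ∈ A[y] equals m̄ · (a−b)^{p^j}. Consequently, if (y+a)^m = (y+b)^m in A[y], then m̄ · (a−b)^{p^j} = 0 in A. -/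
open Polynomial

/-- In characteristic `p`, the second-highest potentially nonzero coefficient of
`(y + a) ^ (p ^ j * (n + 1))`, in degree `p ^ j * n`, is `(n + 1) * a ^ p ^ j`. -/
theorem coeff_X_add_C_pow_prime_pow_mul_succ {A : Type*} [CommRing A] (p : ℕ) [Fact p.Prime]
    [CharP A p] (j n : ℕ) (a : A) :
    ((X + C a) ^ (p ^ j * (n + 1))).coeff (p ^ j * n) = (n + 1) • a ^ p ^ j := by
  have hpos : 0 < p ^ j := pow_pos (Fact.out : p.Prime).pos j
  have hexpand : (X + C a) ^ (p ^ j * (n + 1)) =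
      expand A (p ^ j) ((X + C (a ^ p ^ j)) ^ (n + 1)) := by
    rw [pow_mul, add_pow_char_pow, map_pow, map_add, expand_X, expand_C, C_pow]
  rw [hexpand, coeff_expand_mul' hpos, coeff_X_add_C_pow]
  simp [mul_comm]

/-- Let `p` be a prime and `A` a commutative ring of characteristic `p`.  For `j ≥ 0`,
`m̄ ≥ 1` and `m = p^j · m̄`, the coefficient of `y^{m - p^j}` in
`(y + a)^m - (y + b)^m ∈ A[y]` equals `m̄ · (a - b)^{p^j}`.  Consequently, if
`(y + a)^m = (y + b)^m` in `A[y]`, then `m̄ · (a - b)^{p^j} = 0` in `A`. -/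
theorem coeff_sub_pow_linear_charP
    (p : ℕ) (hp : p.Prime) (A : Type*) [CommRing A] [CharP A p]
    (j mbar : ℕ) (hmbar : 1 ≤ mbar) (m : ℕ) (hm : m = p ^ j * mbar) (a b : A) :
    (((X + C a) ^ m - (X + C b) ^ m).coeff (m - p ^ j) = mbar • (a - b) ^ p ^ j)
    ∧ ((X + C a) ^ m = (X + C b) ^ m → mbar • (a - b) ^ p ^ j = 0) := by
  have : Fact p.Prime := ⟨hp⟩
  have hcoeff :
      ((X + C a) ^ m - (X + C b) ^ m).coeff (m - p ^ j) = mbar • (a - b) ^ p ^ j := by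
    obtain ⟨n, rfl⟩ := Nat.exists_eq_add_of_le' hmbar
    have hdeg : m - p ^ j = p ^ j * n := by rw [hm, mul_add_one, Nat.add_sub_cancel]
    rw [hdeg, hm, coeff_sub, coeff_X_add_C_pow_prime_pow_mul_succ,
      coeff_X_add_C_pow_prime_pow_mul_succ, ← smul_sub, sub_pow_char_pow]
  exact ⟨hcoeff, fun h => by rw [← hcoeff, h, sub_self, coeff_zero]⟩
end

section
/- Let f ∈ ℂ[x,y] be a nonzero polynomial with f(0,0) = 0 whose image in the formal power series ring R = ℂ⟦x,y⟧ is squarefree, so that the complete local ring O = R/⟨f⟩ of the reduced plane curve singularity defined by f is reduced. Define the Milnor number μ(f) = dim_ℂ R/⟨∂f/∂x, ∂f/∂y⟩ (the partial derivatives taken in ℂ[x,y] and regarded as elements of R), the number of branches r(f) = the number of irreducible factors of the image of f in R (these are pairwise non-associate and each occurs exactly once, since f is squarefree in R), and the delta invariant δ(f) = dim_ℂ Ō/O, where Ō is the integral closure (normalization) of O in its total ring of fractions. Then μ(f), δ(f) are finite, and μ(f) = 2·δ(f) − r(f) + 1. -/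
set_option maxHeartbeats 1000000
set_option synthInstance.maxHeartbeats 400000

noncomputable section

/-- The ring `R = ℂ⟦x,y⟧` of formal power series in two variables over `ℂ`. -/
abbrev PlanePS : Type := MvPowerSeries (Fin 2) ℂ

/-- The canonical inclusion `ℂ[x,y] → ℂ⟦x,y⟧`. -/
def toPS : MvPolynomial (Fin 2) ℂ →+* PlanePS :=
  MvPolynomial.coeToMvPowerSeries.ringHom

/-- The Milnor algebra `R/⟨∂f/∂x, ∂f/∂y⟩`. -/
abbrev MilnorAlgebra (f : MvPolynomial (Fin 2) ℂ) : Type :=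
  PlanePS ⧸ Ideal.span {toPS (MvPolynomial.pderiv 0 f), toPS (MvPolynomial.pderiv 1 f)}

/-- The complete local ring `O = R/⟨f⟩` of the plane curve singularity `{f = 0}`. -/
abbrev CurveRing (f : MvPolynomial (Fin 2) ℂ) : Type :=
  PlanePS ⧸ Ideal.span {toPS f}

-- Shortcut instances (all found by `inferInstance`; they only speed up/stabilize
-- typeclass resolution and introduce no new mathematical content).
instance (f : MvPolynomial (Fin 2) ℂ) : CommRing (FractionRing (CurveRing f)) :=
  inferInstance

instance (f : MvPolynomial (Fin 2) ℂ) : Algebra (CurveRing f) (FractionRing (CurveRing f)) :=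
  inferInstance

instance (f : MvPolynomial (Fin 2) ℂ) : Algebra ℂ (FractionRing (CurveRing f)) :=
  inferInstance

instance (f : MvPolynomial (Fin 2) ℂ) :
    IsScalarTower ℂ (CurveRing f) (FractionRing (CurveRing f)) :=
  inferInstance

/-- The normalization `Ō` of `O`: the integral closure of `O` in its total ring of
fractions (the localization of `O` at the multiplicative set of nonzerodivisors). -/
abbrev Normalization (f : MvPolynomial (Fin 2) ℂ) : Type :=
  integralClosure (CurveRing f) (FractionRing (CurveRing f))

instance (f : MvPolynomial (Fin 2) ℂ) : CommRing (Normalization f) :=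
  Subalgebra.toCommRing _

instance (f : MvPolynomial (Fin 2) ℂ) : Algebra (CurveRing f) (Normalization f) :=
  inferInstance

instance (f : MvPolynomial (Fin 2) ℂ) : Module ℂ (Normalization f) :=
  inferInstance

instance (f : MvPolynomial (Fin 2) ℂ) :
    IsScalarTower ℂ (CurveRing f) (Normalization f) :=
  inferInstance

/-- The quotient `Ō/O` of the normalization by the canonical image of `O`,
as a `ℂ`-vector space. -/
abbrev DeltaModule (f : MvPolynomial (Fin 2) ℂ) : Type :=
  Normalization f ⧸ LinearMap.range
    ((Algebra.linearMap (CurveRing f) (Normalization f)).restrictScalars ℂ)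

section

open scoped Polynomial PowerSeries

/-- `ℂ⟦x⟧` is complete with respect to its maximal ideal. -/
instance isAdicComplete_maximalIdeal_powerSeries :
    IsAdicComplete (IsLocalRing.maximalIdeal ℂ⟦X⟧) ℂ⟦X⟧ := by
  rw [PowerSeries.maximalIdeal_eq_span_X]
  infer_instance

lemma mem_maximalIdeal_powerSeries_iff {a : ℂ⟦X⟧} :
    a ∈ IsLocalRing.maximalIdeal ℂ⟦X⟧ ↔ PowerSeries.constantCoeff a = 0 := by
  rw [PowerSeries.maximalIdeal_eq_span_X, Ideal.mem_span_singleton, PowerSeries.X_dvd_iff]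

lemma map_residue_ne_zero {F : ℂ⟦X⟧⟦X⟧}
    (hF : F.map (PowerSeries.constantCoeff (R := ℂ)) ≠ 0) :
    F.map (IsLocalRing.residue ℂ⟦X⟧) ≠ 0 := by
  intro h
  apply hF
  ext n
  have h1 := congrArg (PowerSeries.coeff n) h
  rw [PowerSeries.coeff_map, map_zero, IsLocalRing.residue_eq_zero_iff,
    mem_maximalIdeal_powerSeries_iff] at h1
  rw [PowerSeries.coeff_map, h1, map_zero]

/-- A distinguished polynomial dividing a polynomial as power series divides it as polynomials. -/
lemma Polynomial.IsDistinguishedAt.dvd_of_coe_dvd_coe {H G : ℂ⟦X⟧[X]}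
    (hH : H.IsDistinguishedAt (IsLocalRing.maximalIdeal ℂ⟦X⟧))
    (h : (H : ℂ⟦X⟧⟦X⟧) ∣ (G : ℂ⟦X⟧⟦X⟧)) : H ∣ G := by
  obtain ⟨q, hq⟩ := h
  have hfac : PowerSeries.IsWeierstrassFactorization (H : ℂ⟦X⟧⟦X⟧) H 1 :=
    ⟨hH, isUnit_one, (mul_one _).symm⟩
  have hdeg : (G %ₘ H).degree < (((H : ℂ⟦X⟧⟦X⟧).map (Ideal.Quotient.mk
      (IsLocalRing.maximalIdeal ℂ⟦X⟧))).order.toNat : ℕ) := by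
    have := Polynomial.degree_modByMonic_lt G hH.monic
    rwa [Polynomial.degree_eq_natDegree hH.monic.ne_zero,
      hfac.natDegree_eq_toNat_order_map] at this
  have hdiv : (H : ℂ⟦X⟧⟦X⟧) * ((G /ₘ H : ℂ⟦X⟧[X]) : ℂ⟦X⟧⟦X⟧) + ((G %ₘ H : ℂ⟦X⟧[X]) : ℂ⟦X⟧⟦X⟧) =
      (H : ℂ⟦X⟧⟦X⟧) * q + ((0 : ℂ⟦X⟧[X]) : ℂ⟦X⟧⟦X⟧) := by
    rw [Polynomial.coe_zero, add_zero, ← hq, ← Polynomial.coe_mul, ← Polynomial.coe_add,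
      add_comm, Polynomial.modByMonic_add_div]
  have := (hH.isWeierstrassDivisorAt'.eq_of_mul_add_eq_mul_add hdeg (by simp) hdiv).2
  exact (Polynomial.modByMonic_eq_zero_iff_dvd hH.monic).mp this

/-- The substitution `x ↦ x ^ m` on `ℂ⟦x⟧`, as a ring homomorphism. -/
abbrev expandHom (m : ℕ) (hm : m ≠ 0) : ℂ⟦X⟧ →+* ℂ⟦X⟧ :=
  ((PowerSeries.expand m hm : ℂ⟦X⟧ →ₐ[ℂ] ℂ⟦X⟧) : ℂ⟦X⟧ →+* ℂ⟦X⟧)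

/-- A polynomial over `ℂ⟦x⟧` has a Puiseux root if it acquires a root in `ℂ⟦t⟧` after the
substitution `x = t ^ m` for some `m ≥ 1`. -/
def HasPuiseuxRoot (Q : ℂ⟦X⟧[X]) : Prop :=
  ∃ (m : ℕ) (hm : m ≠ 0) (y : ℂ⟦X⟧),
    Q.eval₂ (expandHom m hm) y = 0

lemma HasPuiseuxRoot.of_taylor {Q : ℂ⟦X⟧[X]} (a : ℂ⟦X⟧)
    (h : HasPuiseuxRoot (Polynomial.taylor a Q)) : HasPuiseuxRoot Q := by
  obtain ⟨m, hm, y, hy⟩ := h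
  refine ⟨m, hm, y + expandHom m hm a, ?_⟩
  rw [Polynomial.taylor_apply, Polynomial.eval₂_comp] at hy
  simpa using hy

lemma HasPuiseuxRoot.of_dvd {Q H : ℂ⟦X⟧[X]} (h : HasPuiseuxRoot H) (hd : H ∣ Q) :
    HasPuiseuxRoot Q := by
  obtain ⟨m, hm, y, hy⟩ := h
  refine ⟨m, hm, y, ?_⟩
  obtain ⟨R, rfl⟩ := hd
  rw [Polynomial.eval₂_mul, hy, zero_mul]

/-- If the reduction of a monic polynomial modulo `x` vanishes at `0` but is not a power of the
variable, then the polynomial has a proper monic factor of positive degree. -/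
lemma exists_monic_dvd_of_map_constantCoeff_ne {G : ℂ⟦X⟧[X]} (hG : G.Monic)
    (h0 : PowerSeries.constantCoeff (G.coeff 0) = 0)
    (hne : ∃ i < G.natDegree, PowerSeries.constantCoeff (G.coeff i) ≠ 0) :
    ∃ H : ℂ⟦X⟧[X], H.Monic ∧ 0 < H.natDegree ∧ H.natDegree < G.natDegree ∧ H ∣ G := by
  have hmap : (G : ℂ⟦X⟧⟦X⟧).map (IsLocalRing.residue ℂ⟦X⟧) ≠ 0 := by
    apply map_residue_ne_zero
    intro h
    have := congrArg (PowerSeries.coeff G.natDegree) h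
    rw [PowerSeries.coeff_map, Polynomial.coeff_coe, hG.coeff_natDegree] at this
    simp at this
  obtain ⟨H, h, hH⟩ := PowerSeries.exists_isWeierstrassFactorization hmap
  have hdvd : H ∣ G := hH.isDistinguishedAt.dvd_of_coe_dvd_coe ⟨h, hH.eq_mul⟩
  refine ⟨H, hH.isDistinguishedAt.monic, ?_, ?_, hdvd⟩
  · by_contra hdeg
    have h1 : H = 1 := hH.isDistinguishedAt.monic.natDegree_eq_zero.mp (by omega)
    have h2 := hH.eq_mul
    rw [h1, Polynomial.coe_one, one_mul] at h2
    have h3 := PowerSeries.isUnit_iff_constantCoeff.mp hH.isUnit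
    rw [← h2, ← PowerSeries.coeff_zero_eq_constantCoeff_apply, Polynomial.coeff_coe,
      PowerSeries.isUnit_iff_constantCoeff, h0] at h3
    simp at h3
  · refine lt_of_le_of_ne (Polynomial.natDegree_le_of_dvd hdvd hG.ne_zero) fun hdeg ↦ ?_
    have h1 : H = G := (Polynomial.eq_of_monic_of_dvd_of_natDegree_le
      hH.isDistinguishedAt.monic hG hdvd hdeg.ge).symm
    obtain ⟨i, hi, hi0⟩ := hne
    have := hH.isDistinguishedAt.mem (n := i) (by omega)
    rw [h1, mem_maximalIdeal_powerSeries_iff] at this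
    exact hi0 this

/-- Puiseux roots can be transported along the Newton polygon rescaling
`x = t ^ q`, `Y = t ^ p Z`. -/
lemma HasPuiseuxRoot.of_rescaled {Q Q₁ : ℂ⟦X⟧[X]} (hQ : Q.Monic) (hQ₁ : Q₁.Monic)
    (hdeg : Q₁.natDegree = Q.natDegree) {p q : ℕ} (hq : q ≠ 0)
    (hc : ∀ i < Q.natDegree, expandHom q hq (Q.coeff i) =
      PowerSeries.X ^ (p * (Q.natDegree - i)) * Q₁.coeff i)
    (h : HasPuiseuxRoot Q₁) : HasPuiseuxRoot Q := by
  obtain ⟨m, hm, z, hz⟩ := h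
  refine ⟨m * q, mul_ne_zero hm hq, PowerSeries.X ^ (m * p) * z, ?_⟩
  have hc' : ∀ i ≤ Q.natDegree, expandHom q hq (Q.coeff i) =
      PowerSeries.X ^ (p * (Q.natDegree - i)) * Q₁.coeff i := by
    intro i hi
    rcases hi.lt_or_eq with h | rfl
    · exact hc i h
    · have h1 : Q₁.coeff Q.natDegree = 1 := by rw [← hdeg, hQ₁.coeff_natDegree]
      rw [h1, hQ.coeff_natDegree]
      simp
  have key : Q.eval₂ (expandHom (m * q) (mul_ne_zero hm hq)) (PowerSeries.X ^ (m * p) * z) =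
      PowerSeries.X ^ (m * p * Q.natDegree) * Q₁.eval₂ (expandHom m hm) z := by
    rw [Polynomial.eval₂_eq_sum_range, Polynomial.eval₂_eq_sum_range, hdeg, Finset.mul_sum]
    refine Finset.sum_congr rfl fun i hi ↦ ?_
    have hi' : i ≤ Q.natDegree := by simpa [Nat.lt_succ_iff] using hi
    have h1 : expandHom (m * q) (mul_ne_zero hm hq) (Q.coeff i) =
        expandHom m hm (expandHom q hq (Q.coeff i)) :=
      PowerSeries.expand_mul m hm q hq _
    have h2 : expandHom m hm PowerSeries.X = PowerSeries.X ^ m := PowerSeries.expand_X m hm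
    rw [h1, hc' i hi', map_mul, map_pow, h2, mul_pow, ← pow_mul, ← pow_mul]
    have h3 : m * p * Q.natDegree = m * (p * (Q.natDegree - i)) + m * p * i := by
      obtain ⟨k, hk⟩ := Nat.exists_eq_add_of_le hi'
      rw [hk, Nat.add_sub_cancel_left]
      ring
    rw [h3, pow_add]
    ring
  rw [key, hz, mul_zero]

/-- The Newton polygon rescaling of a monic polynomial other than a power of the variable. -/
lemma exists_rescaled {Q : ℂ⟦X⟧[X]} (hne : ∃ i < Q.natDegree, Q.coeff i ≠ 0) :
    ∃ (p q : ℕ) (hq : q ≠ 0) (Q₁ : ℂ⟦X⟧[X]), Q₁.Monic ∧ Q₁.natDegree = Q.natDegree ∧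
      (∀ i < Q.natDegree, expandHom q hq (Q.coeff i) =
        PowerSeries.X ^ (p * (Q.natDegree - i)) * Q₁.coeff i) ∧
      ∃ i < Q.natDegree, PowerSeries.constantCoeff (Q₁.coeff i) ≠ 0 := by
  classical
  set d := Q.natDegree with hd
  let s := (Finset.range d).filter fun i ↦ Q.coeff i ≠ 0
  have hs : s.Nonempty := by
    obtain ⟨i, hi, hi0⟩ := hne
    exact ⟨i, by simp [s, hi, hi0]⟩
  obtain ⟨i₀, hi₀, hmin⟩ := s.exists_min_image
    (fun i ↦ ((Q.coeff i).order.toNat : ℚ) / ((d - i : ℕ) : ℚ)) hs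
  simp only [s, Finset.mem_filter, Finset.mem_range] at hi₀ hmin
  have hq : d - i₀ ≠ 0 := by omega
  set p := (Q.coeff i₀).order.toNat with hp
  have hdvd : ∀ i < d, ∃ b : ℂ⟦X⟧, expandHom (d - i₀) hq (Q.coeff i) =
      PowerSeries.X ^ (p * (d - i)) * b := by
    intro i hi
    by_cases h0 : Q.coeff i = 0
    · exact ⟨0, by rw [h0, map_zero, mul_zero]⟩
    have h1 := hmin i ⟨hi, h0⟩
    rw [div_le_div_iff₀ (by exact_mod_cast Nat.pos_of_ne_zero hq)
      (by exact_mod_cast Nat.sub_pos_of_lt hi)] at h1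
    have h2 : p * (d - i) ≤ (Q.coeff i).order.toNat * (d - i₀) := by exact_mod_cast h1
    obtain ⟨b, hb⟩ : PowerSeries.X ^ (Q.coeff i).order.toNat ∣ Q.coeff i :=
      PowerSeries.X_pow_order_dvd
    obtain ⟨k, hk⟩ := Nat.exists_eq_add_of_le h2
    refine ⟨PowerSeries.X ^ k * expandHom (d - i₀) hq b, ?_⟩
    have h3 : expandHom (d - i₀) hq PowerSeries.X = PowerSeries.X ^ (d - i₀) :=
      PowerSeries.expand_X _ hq
    conv_lhs => rw [hb]
    rw [map_mul, map_pow, h3, ← pow_mul, mul_comm (d - i₀), hk, pow_add, mul_assoc]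
  choose! b hb using hdvd
  let Q₁ : ℂ⟦X⟧[X] := Polynomial.X ^ d + ∑ i ∈ Finset.range d, Polynomial.C (b i) * Polynomial.X ^ i
  have hlow : (∑ i ∈ Finset.range d, Polynomial.C (b i) * Polynomial.X ^ i).degree <
      ((d : ℕ) : WithBot ℕ) := by
    refine (Polynomial.degree_sum_le _ _).trans_lt ?_
    rw [Finset.sup_lt_iff (by exact WithBot.bot_lt_coe d)]
    intro i hi
    refine (Polynomial.degree_C_mul_X_pow_le _ _).trans_lt ?_
    exact_mod_cast Finset.mem_range.mp hi
  have hQ₁deg : Q₁.natDegree = d := by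
    apply Polynomial.natDegree_eq_of_degree_eq_some
    rw [Polynomial.degree_add_eq_left_of_degree_lt] <;> rw [Polynomial.degree_X_pow]
    exact hlow
  have hcoeff : ∀ i < d, Q₁.coeff i = b i := by
    intro i hi
    simp only [Q₁, Polynomial.coeff_add, Polynomial.coeff_X_pow, Polynomial.finsetSum_coeff,
      Polynomial.coeff_C_mul]
    rw [if_neg hi.ne, zero_add, Finset.sum_eq_single i]
    · simp
    · intro j _ hj
      simp [Ne.symm hj]
    · simp [hi]
  refine ⟨p, d - i₀, hq, Q₁, Polynomial.monic_X_pow_add hlow, hQ₁deg, ?_, i₀, hi₀.1, ?_⟩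
  · intro i hi
    rw [hcoeff i hi, hb i hi]
  · rw [hcoeff i₀ hi₀.1]
    have h1 := congrArg (PowerSeries.coeff (p * (d - i₀))) (hb i₀ hi₀.1)
    rw [PowerSeries.coeff_X_pow_mul', if_pos le_rfl, Nat.sub_self,
      PowerSeries.coeff_zero_eq_constantCoeff_apply] at h1
    rw [← h1, mul_comm]
    have h2 := PowerSeries.coeff_expand_mul (d - i₀) hq (Q.coeff i₀) p
    refine ne_of_eq_of_ne h2 ?_
    exact PowerSeries.coeff_order hi₀.2

lemma coeff_taylor_natDegree_sub_one {R : Type*} [CommRing R] {Q : R[X]} (hQ : Q.Monic)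
    (hd : 0 < Q.natDegree) (a : R) :
    (Polynomial.taylor a Q).coeff (Q.natDegree - 1) =
      Q.coeff (Q.natDegree - 1) + Q.natDegree * a := by
  rw [Polynomial.taylor_coeff]
  have h1 : (Polynomial.hasseDeriv (Q.natDegree - 1) Q).natDegree ≤ 1 :=
    (Polynomial.natDegree_hasseDeriv_le _ _).trans (by omega)
  rw [Polynomial.eq_X_add_C_of_natDegree_le_one h1, Polynomial.hasseDeriv_coeff,
    Polynomial.hasseDeriv_coeff]
  have h2 : 1 + (Q.natDegree - 1) = Q.natDegree := by omega
  have h3 : Q.natDegree.choose (Q.natDegree - 1) = Q.natDegree := by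
    rw [Nat.choose_symm (by omega)]; simp
  rw [h2, hQ.coeff_natDegree, zero_add, Nat.choose_self, h3]
  simp
  ring

/-- **Newton–Puiseux**: a monic polynomial of positive degree over `ℂ⟦x⟧` has a root in
`ℂ⟦x ^ (1 / m)⟧` for some `m ≥ 1`. -/
theorem hasPuiseuxRoot_of_monic {Q : ℂ⟦X⟧[X]} (hQ : Q.Monic) (hd : 0 < Q.natDegree) :
    HasPuiseuxRoot Q := by
  induction hn : Q.natDegree using Nat.strong_induction_on generalizing Q with
  | _ n ih =>
  subst hn
  -- depress the polynomial
  let a : ℂ⟦X⟧ := PowerSeries.C (-(1 / (Q.natDegree : ℂ))) * Q.coeff (Q.natDegree - 1)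
  apply HasPuiseuxRoot.of_taylor a
  have hTm : (Polynomial.taylor a Q).Monic := by
    rw [Polynomial.Monic, Polynomial.leadingCoeff_taylor]; exact hQ
  have hTd : (Polynomial.taylor a Q).natDegree = Q.natDegree := Polynomial.natDegree_taylor Q a
  have hT0 : (Polynomial.taylor a Q).coeff (Q.natDegree - 1) = 0 := by
    rw [coeff_taylor_natDegree_sub_one hQ hd]
    have : ((Q.natDegree : ℕ) : ℂ⟦X⟧) * PowerSeries.C (-(1 / (Q.natDegree : ℂ))) = -1 := by
      rw [← map_natCast (PowerSeries.C (R := ℂ)), ← map_mul]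
      have : (Q.natDegree : ℂ) ≠ 0 := by exact_mod_cast hd.ne'
      rw [mul_neg, mul_one_div_cancel this]
      simp
    rw [← mul_assoc, this]
    ring
  generalize Polynomial.taylor a Q = T at hTm hTd hT0
  rw [← hTd] at ih hT0 hd
  by_cases hne : ∃ i < T.natDegree, T.coeff i ≠ 0
  swap
  · push Not at hne
    refine ⟨1, one_ne_zero, 0, ?_⟩
    rw [Polynomial.eval₂_at_zero, hne 0 hd, map_zero]
  obtain ⟨p, q, hq, Q₁, hQ₁, hdeg, hc, i₀, hi₀, hi₀'⟩ := exists_rescaled hne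
  apply HasPuiseuxRoot.of_rescaled hTm hQ₁ hdeg hq hc
  have hQ₁0 : PowerSeries.constantCoeff (Q₁.coeff (Q₁.natDegree - 1)) = 0 := by
    have h1 := hc (T.natDegree - 1) (by omega)
    rw [hT0, map_zero, eq_comm, mul_eq_zero] at h1
    rw [hdeg, h1.resolve_left (pow_ne_zero _ PowerSeries.X_ne_zero), map_zero]
  rw [← hdeg] at hi₀ hd ih
  let q₁ : ℂ[X] := Q₁.map PowerSeries.constantCoeff
  have hq₁ : q₁.Monic := hQ₁.map _
  have hq₁d : q₁.natDegree = Q₁.natDegree := hQ₁.natDegree_map _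
  obtain ⟨c, hcroot⟩ := IsAlgClosed.exists_root q₁ (by
    rw [Polynomial.degree_eq_natDegree hq₁.ne_zero, hq₁d]; exact_mod_cast hd.ne')
  apply HasPuiseuxRoot.of_taylor (PowerSeries.C c)
  let G := Polynomial.taylor (PowerSeries.C c) Q₁
  have hGm : G.Monic := by
    rw [Polynomial.Monic, Polynomial.leadingCoeff_taylor]; exact hQ₁
  have hGd : G.natDegree = Q₁.natDegree := Polynomial.natDegree_taylor _ _
  have hGmap : G.map PowerSeries.constantCoeff = Polynomial.taylor c q₁ := by
    simp [G, q₁, Polynomial.taylor_apply, Polynomial.map_comp]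
  have hGc : ∀ i, PowerSeries.constantCoeff (G.coeff i) = (Polynomial.taylor c q₁).coeff i := by
    intro i; rw [← hGmap, Polynomial.coeff_map]
  obtain ⟨H, hHm, hH0, hHd, hHG⟩ := exists_monic_dvd_of_map_constantCoeff_ne hGm
    (by rw [hGc, Polynomial.taylor_coeff_zero]; exact hcroot) (by
      by_contra hall
      push Not at hall
      have h1 := coeff_taylor_natDegree_sub_one hq₁ (by omega) c
      rw [← hGc, hall _ (by omega), hq₁d, Polynomial.coeff_map, hQ₁0, zero_add, eq_comm,
        mul_eq_zero] at h1
      have hc0 : c = 0 := h1.resolve_left (by exact_mod_cast hd.ne')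
      apply hi₀'
      have := hall i₀ (by omega)
      rwa [hGc, hc0, Polynomial.taylor_zero, Polynomial.coeff_map] at this)
  exact (ih H.natDegree (by omega) hHm hH0 rfl).of_dvd hHG

/-- The standard primitive `n`-th root of unity. -/
def stdRoot (n : ℕ) : ℂ := Complex.exp (2 * Real.pi * Complex.I / n)

lemma stdRoot_isPrimitiveRoot {n : ℕ} (hn : n ≠ 0) : IsPrimitiveRoot (stdRoot n) n :=
  Complex.isPrimitiveRoot_exp n hn

lemma expandHom_injective {m : ℕ} (hm : m ≠ 0) : Function.Injective (expandHom m hm) := by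
  intro a b h
  ext i
  have := congrArg (PowerSeries.coeff (m * i)) h
  simpa [PowerSeries.coeff_expand_mul] using this

lemma rescale_expandHom {m : ℕ} (hm : m ≠ 0) (c : ℂ) (a : ℂ⟦X⟧) :
    PowerSeries.rescale c (expandHom m hm a) = expandHom m hm (PowerSeries.rescale (c ^ m) a) := by
  ext i
  simp only [expandHom, RingHom.coe_coe, PowerSeries.coeff_rescale, PowerSeries.coeff_expand]
  split_ifs with h
  · obtain ⟨j, rfl⟩ := h
    rw [Nat.mul_div_cancel_left _ (Nat.pos_of_ne_zero hm), pow_mul]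
  · simp

lemma eq_expandHom_of_forall_dvd {m : ℕ} (hm : m ≠ 0) {a : ℂ⟦X⟧}
    (h : ∀ i, PowerSeries.coeff i a ≠ 0 → m ∣ i) :
    a = expandHom m hm (PowerSeries.mk fun i => PowerSeries.coeff (m * i) a) := by
  ext i
  simp only [expandHom, RingHom.coe_coe, PowerSeries.coeff_expand]
  split_ifs with hi
  · obtain ⟨j, rfl⟩ := hi
    rw [Nat.mul_div_cancel_left _ (Nat.pos_of_ne_zero hm), PowerSeries.coeff_mk]
  · by_contra h0
    exact hi (h i h0)

lemma rescale_eq_zero_iff {c : ℂ} (hc : c ≠ 0) {a : ℂ⟦X⟧} :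
    PowerSeries.rescale c a = 0 ↔ a = 0 := by
  constructor
  · intro h
    have := congrArg (PowerSeries.rescale c⁻¹) h
    rwa [PowerSeries.rescale_rescale, mul_inv_cancel₀ hc, PowerSeries.rescale_one, map_zero] at this
  · rintro rfl; simp

/-- The substitution `t ↦ ζ ^ k t` carries roots to roots. -/
lemma eval₂_expandHom_rescale {m : ℕ} (hm : m ≠ 0) {c : ℂ} (hc : c ^ m = 1) (Q : ℂ⟦X⟧[X])
    (y : ℂ⟦X⟧) :
    Q.eval₂ (expandHom m hm) (PowerSeries.rescale c y) =
      PowerSeries.rescale c (Q.eval₂ (expandHom m hm) y) := by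
  rw [Polynomial.hom_eval₂]
  congr 1
  ext1 a
  rw [RingHom.comp_apply, rescale_expandHom, hc, PowerSeries.rescale_one, RingHom.id_apply]

lemma prod_conjugates_dvd_map {m : ℕ} (hm : m ≠ 0) {y : ℂ⟦X⟧}
    (hinj : Function.Injective fun k : Fin m => PowerSeries.rescale (stdRoot m ^ (k : ℕ)) y)
    {Q : ℂ⟦X⟧[X]} (hQ : Q.eval₂ (expandHom m hm) y = 0) :
    ∏ k : Fin m, (Polynomial.X - Polynomial.C (PowerSeries.rescale (stdRoot m ^ (k : ℕ)) y)) ∣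
      Q.map (expandHom m hm) := by
  classical
  rcases eq_or_ne Q 0 with rfl | h0
  · simp
  have h0' : Q.map (expandHom m hm) ≠ 0 := by
    rwa [Ne, Polynomial.map_eq_zero_iff (expandHom_injective hm)]
  have := (Multiset.prod_X_sub_C_dvd_iff_le_roots h0'
    (Finset.univ.val.map fun k : Fin m => PowerSeries.rescale (stdRoot m ^ (k : ℕ)) y)).2 (by
      rw [Multiset.le_iff_subset (Finset.univ.nodup.map hinj)]
      intro r hr
      obtain ⟨k, -, rfl⟩ := Multiset.mem_map.1 hr
      rw [Polynomial.mem_roots h0', Polynomial.IsRoot, Polynomial.eval_map,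
        eval₂_expandHom_rescale hm, hQ, map_zero]
      rw [← pow_mul, mul_comm, pow_mul, (stdRoot_isPrimitiveRoot hm).pow_eq_one, one_pow])
  rw [Multiset.map_map] at this
  exact this

/-- An irreducible monic polynomial over `ℂ⟦x⟧`, given by its Puiseux parametrization
`x = t ^ deg`, `y = param`. -/
structure PuiseuxBranch where
  /-- The degree of the branch over the `x`-axis. -/
  deg : ℕ
  deg_ne : deg ≠ 0
  /-- The Puiseux series. -/
  param : ℂ⟦X⟧
  /-- The minimal polynomial of the Puiseux series. -/
  poly : ℂ⟦X⟧[X]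
  monic : poly.Monic
  map_poly : poly.map (expandHom deg deg_ne) =
    ∏ k : Fin deg, (Polynomial.X - Polynomial.C (PowerSeries.rescale (stdRoot deg ^ (k : ℕ)) param))
  injective : Function.Injective fun k : Fin deg =>
    PowerSeries.rescale (stdRoot deg ^ (k : ℕ)) param

namespace PuiseuxBranch

/-- Pullback of functions to the normalization of the branch. -/
def eval (B : PuiseuxBranch) : ℂ⟦X⟧[X] →+* ℂ⟦X⟧ :=
  Polynomial.eval₂RingHom (expandHom B.deg B.deg_ne) B.param

lemma eval_apply (B : PuiseuxBranch) (g : ℂ⟦X⟧[X]) :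
    B.eval g = g.eval₂ (expandHom B.deg B.deg_ne) B.param := rfl

lemma eval_C (B : PuiseuxBranch) (a : ℂ⟦X⟧) :
    B.eval (Polynomial.C a) = expandHom B.deg B.deg_ne a := by
  rw [eval_apply, Polynomial.eval₂_C]

lemma eval_X (B : PuiseuxBranch) : B.eval Polynomial.X = B.param := by
  rw [eval_apply, Polynomial.eval₂_X]

lemma natDegree_poly (B : PuiseuxBranch) : B.poly.natDegree = B.deg := by
  rw [← B.monic.natDegree_map (expandHom B.deg B.deg_ne), B.map_poly,
    Polynomial.natDegree_prod_of_monic _ _ fun k _ => Polynomial.monic_X_sub_C _]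
  simp

lemma eval_eq_zero_iff (B : PuiseuxBranch) {g : ℂ⟦X⟧[X]} : B.eval g = 0 ↔ B.poly ∣ g := by
  constructor
  · intro h
    have := prod_conjugates_dvd_map B.deg_ne B.injective h
    rw [← B.map_poly] at this
    exact (Polynomial.map_dvd_map _ (expandHom_injective B.deg_ne) B.monic).1 this
  · rintro ⟨q, rfl⟩
    rw [map_mul, eval_apply, ← Polynomial.eval_map, B.map_poly, Polynomial.eval_prod,
      Finset.prod_eq_zero (Finset.mem_univ ⟨0, Nat.pos_of_ne_zero B.deg_ne⟩) (by simp), zero_mul]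

lemma poly_prime (B : PuiseuxBranch) : Prime B.poly := by
  refine ⟨B.monic.ne_zero, ?_, ?_⟩
  · intro h
    have h2 := B.monic.isUnit_iff.1 h
    have h3 := B.natDegree_poly
    rw [h2, Polynomial.natDegree_one] at h3
    exact B.deg_ne h3.symm
  · intro a b h
    rw [← eval_eq_zero_iff, map_mul, mul_eq_zero] at h
    simpa [← eval_eq_zero_iff] using h

/-- Newton–Puiseux: every non-constant monic polynomial is divisible by the polynomial of a
branch. -/
theorem exists_dvd {Q : ℂ⟦X⟧[X]} (hQ : Q.Monic) (hd : 0 < Q.natDegree) :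
    ∃ B : PuiseuxBranch, B.poly ∣ Q := by
  classical
  have hex := hasPuiseuxRoot_of_monic hQ hd
  set m := Nat.find hex with hm_def
  obtain ⟨hm, y, hy⟩ := Nat.find_spec hex
  rw [← hm_def] at hm
  simp only [← hm_def] at hy
  have hζ := stdRoot_isPrimitiveRoot hm
  have key : ∀ k l : ℕ, k < l → l < m → PowerSeries.rescale (stdRoot m ^ k) y ≠
      PowerSeries.rescale (stdRoot m ^ l) y := by
    intro k l hkl hlm heq
    set e := l - k with he
    have hg0 : m.gcd e ≠ 0 := Nat.gcd_ne_zero_left hm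
    have hgm : m.gcd e ∣ m := Nat.gcd_dvd_left _ _
    obtain ⟨d, hd'⟩ := hgm
    have hd0 : d ≠ 0 := by rintro rfl; exact hm (by simpa using hd')
    have hge : m.gcd e ≤ e := Nat.le_of_dvd (by omega) (Nat.gcd_dvd_right _ _)
    have hdvd : ∀ i, PowerSeries.coeff i y ≠ 0 → d ∣ i := by
      intro i hi
      have h1 := congrArg (PowerSeries.coeff i) heq
      rw [PowerSeries.coeff_rescale, PowerSeries.coeff_rescale] at h1
      have h2 := mul_right_cancel₀ hi h1
      have h3 : stdRoot m ^ (e * i) = 1 := by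
        have h4 : (stdRoot m ^ l) ^ i = (stdRoot m ^ k) ^ i * stdRoot m ^ (e * i) := by
          rw [← pow_mul, ← pow_mul, ← pow_add, ← Nat.add_mul]
          congr 2; omega
        rw [h4] at h2
        have h5 : (stdRoot m ^ k) ^ i ≠ 0 := pow_ne_zero _ (pow_ne_zero _ (hζ.ne_zero hm))
        exact (mul_right_cancel₀ h5 (by rw [one_mul, mul_comm]; exact h2)).symm
      have h4 := (hζ.pow_eq_one_iff_dvd _).1 h3
      obtain ⟨e', he'⟩ := Nat.gcd_dvd_right m e
      have hcop : Nat.Coprime d e' := by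
        have h6 : m / m.gcd e = d := by
          conv_lhs => enter [1]; rw [hd']
          exact Nat.mul_div_cancel_left _ (Nat.pos_of_ne_zero hg0)
        have h7 : e / m.gcd e = e' := by
          conv_lhs => enter [1]; rw [he']
          exact Nat.mul_div_cancel_left _ (Nat.pos_of_ne_zero hg0)
        rw [← h6, ← h7]
        exact Nat.coprime_div_gcd_div_gcd (Nat.pos_of_ne_zero hg0)
      have h5 : m.gcd e * d ∣ m.gcd e * (e' * i) := by
        rw [← hd', ← mul_assoc, ← he']; exact h4
      exact hcop.dvd_of_dvd_mul_left (Nat.dvd_of_mul_dvd_mul_left (Nat.pos_of_ne_zero hg0) h5)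
    have hy2 := eq_expandHom_of_forall_dvd hd0 hdvd
    set z := PowerSeries.mk fun i => PowerSeries.coeff (d * i) y with hz
    have hlt : m.gcd e < m := by omega
    refine Nat.find_min hex hlt ⟨hg0, z, ?_⟩
    apply expandHom_injective hd0
    rw [map_zero, Polynomial.hom_eval₂, ← hy2, ← hy]
    congr 1
    ext1 a
    simp only [expandHom, RingHom.comp_apply, RingHom.coe_coe]
    rw [← PowerSeries.expand_mul]
    simp only [mul_comm d, ← hd']
  have hinj : Function.Injective fun k : Fin m =>
      PowerSeries.rescale (stdRoot m ^ (k : ℕ)) y := by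
    intro k l hkl
    rcases lt_trichotomy k l with h | h | h
    · exact (key k l h l.2 hkl).elim
    · exact h
    · exact (key l k h k.2 hkl.symm).elim
  set G : ℂ⟦X⟧[X] := ∏ k : Fin m,
    (Polynomial.X - Polynomial.C (PowerSeries.rescale (stdRoot m ^ (k : ℕ)) y)) with hG
  have hGmonic : G.Monic :=
    Polynomial.monic_prod_of_monic _ _ fun k _ => Polynomial.monic_X_sub_C _
  have hGinv : G.map (PowerSeries.rescale (stdRoot m)) = G := by
    have h1 : G = ∏ k ∈ Finset.range m,
        (Polynomial.X - Polynomial.C (PowerSeries.rescale (stdRoot m ^ k) y)) :=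
      Fin.prod_univ_eq_prod_range (fun k => (Polynomial.X - Polynomial.C
        (PowerSeries.rescale (stdRoot m ^ k) y))) m
    set φ : ℕ → ℂ⟦X⟧[X] := fun k => Polynomial.X - Polynomial.C
        (PowerSeries.rescale (stdRoot m ^ k) y) with hφ
    have h2 : G.map (PowerSeries.rescale (stdRoot m)) = ∏ k ∈ Finset.range m, φ (k + 1) := by
      rw [h1, Polynomial.map_prod]
      refine Finset.prod_congr rfl fun k _ => ?_
      simp only [hφ, Polynomial.map_sub, Polynomial.map_X, Polynomial.map_C,
        PowerSeries.rescale_rescale, pow_succ]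
    have h3 : (∏ k ∈ Finset.range m, φ (k + 1)) * φ 0 = (∏ k ∈ Finset.range m, φ k) * φ m := by
      rw [← Finset.prod_range_succ', Finset.prod_range_succ]
    have h4 : φ m = φ 0 := by
      simp only [hφ, hζ.pow_eq_one, pow_zero]
    rw [h4] at h3
    rw [h2, h1]
    exact mul_right_cancel₀ (Polynomial.X_sub_C_ne_zero _) h3
  have hlift : G ∈ Polynomial.lifts (expandHom m hm) := by
    rw [Polynomial.lifts_iff_coeff_lifts]
    intro i
    refine ⟨_, (eq_expandHom_of_forall_dvd hm ?_).symm⟩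
    intro j hj
    have h1 := congrArg (fun p => PowerSeries.coeff j (Polynomial.coeff p i)) hGinv
    simp only [Polynomial.coeff_map, PowerSeries.coeff_rescale] at h1
    rw [← hζ.pow_eq_one_iff_dvd]
    exact mul_right_cancel₀ hj (by rw [one_mul]; exact h1)
  obtain ⟨P, hP⟩ := (Polynomial.mem_lifts _).1 hlift
  have hPmonic : P.Monic := by
    rw [(expandHom_injective hm).monic_map_iff, hP]; exact hGmonic
  let B : PuiseuxBranch := ⟨m, hm, y, P, hPmonic, hP, hinj⟩
  exact ⟨B, B.eval_eq_zero_iff.1 hy⟩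

/-- Every monic polynomial over `ℂ⟦x⟧` is a product of polynomials of branches. -/
theorem exists_list_prod {Q : ℂ⟦X⟧[X]} (hQ : Q.Monic) :
    ∃ l : List PuiseuxBranch, Q = (l.map poly).prod := by
  induction hn : Q.natDegree using Nat.strong_induction_on generalizing Q with
  | _ n ih =>
  rcases Nat.eq_zero_or_pos Q.natDegree with h0 | h0
  · exact ⟨[], by simpa using hQ.natDegree_eq_zero.1 h0⟩
  · obtain ⟨B, R, hR⟩ := exists_dvd hQ h0
    have hRm : R.Monic := B.monic.of_mul_monic_left (hR ▸ hQ)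
    have hdeg : Q.natDegree = B.deg + R.natDegree := by
      rw [hR, B.monic.natDegree_mul hRm, natDegree_poly]
    have := B.deg_ne
    obtain ⟨l, hl⟩ := ih R.natDegree (by omega) hRm rfl
    exact ⟨B :: l, by rw [List.map_cons, List.prod_cons, ← hl, hR]⟩

/-- Factors of distinguished polynomials pass through the origin. -/
lemma constantCoeff_param (B : PuiseuxBranch) {Q : ℂ⟦X⟧[X]}
    (hQ : Q.IsDistinguishedAt (IsLocalRing.maximalIdeal ℂ⟦X⟧)) (h : B.poly ∣ Q) :
    PowerSeries.constantCoeff B.param = 0 := by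
  have h0 := B.eval_eq_zero_iff.2 h
  have h1 := congrArg (PowerSeries.constantCoeff (R := ℂ)) h0
  rw [eval_apply, Polynomial.hom_eval₂, map_zero] at h1
  have h2 : (PowerSeries.constantCoeff (R := ℂ)).comp (expandHom B.deg B.deg_ne) =
      PowerSeries.constantCoeff := by
    ext1 a; simp [PowerSeries.constantCoeff_expand]
  rw [h2, ← Polynomial.eval_map] at h1
  have h3 : Q.map (PowerSeries.constantCoeff (R := ℂ)) = Polynomial.X ^ Q.natDegree := by
    ext i
    rw [Polynomial.coeff_map, Polynomial.coeff_X_pow]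
    split_ifs with hi
    · rw [hi, hQ.monic.coeff_natDegree, map_one]
    · rcases lt_or_gt_of_ne hi with h | h
      · exact mem_maximalIdeal_powerSeries_iff.1 (hQ.mem h)
      · rw [Polynomial.coeff_eq_zero_of_natDegree_lt h, map_zero]
  rw [h3, Polynomial.eval_pow, Polynomial.eval_X] at h1
  exact eq_zero_of_pow_eq_zero h1

end PuiseuxBranch

lemma PowerSeries.associated_X_pow {a : ℂ⟦X⟧} (ha : a ≠ 0) {n : ℕ} (hn : (n : ℕ∞) = a.order) :
    Associated a (PowerSeries.X ^ n) := by
  have h3 := PowerSeries.X_pow_order_mul_divXPowOrder (f := a)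
  have hn' : a.order.toNat = n := by rw [← hn]; rfl
  rw [hn'] at h3
  conv_lhs => rw [← h3]
  exact associated_mul_unit_left _ _ (PowerSeries.isUnit_divided_by_X_pow_order ha)

/-- The length of `ℂ⟦x⟧ / (a)` is the order of `a`. -/
lemma length_quotient_span_singleton {a : ℂ⟦X⟧} (ha : a ≠ 0) :
    Module.length ℂ (ℂ⟦X⟧ ⧸ Ideal.span {a}) = a.order := by
  obtain ⟨n, hn⟩ := ENat.ne_top_iff_exists.1 (mt PowerSeries.order_eq_top.1 ha)
  let g : ℂ⟦X⟧ →ₗ[ℂ] (Fin n → ℂ) := LinearMap.pi fun i => PowerSeries.coeff (i : ℕ)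
  have hg : Function.Surjective g := by
    intro v
    refine ⟨PowerSeries.mk fun i => if h : i < n then v ⟨i, h⟩ else 0, ?_⟩
    ext i
    simp [g]
  have hker : LinearMap.ker g = (Ideal.span {a}).restrictScalars ℂ := by
    ext b
    have h1 : a ∣ b ↔ (n : ℕ∞) ≤ b.order := by
      constructor
      · rintro ⟨c, rfl⟩
        rw [PowerSeries.order_mul, ← hn]
        exact le_self_add
      · intro h
        have h2 := (PowerSeries.associated_X_pow ha hn).dvd
        exact h2.trans (PowerSeries.X_pow_dvd_iff.2 fun m hm =>
          PowerSeries.coeff_of_lt_order _ (lt_of_lt_of_le (by exact_mod_cast hm) h))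
    rw [Submodule.restrictScalars_mem, Ideal.mem_span_singleton, h1, LinearMap.mem_ker]
    constructor
    · intro h
      refine PowerSeries.nat_le_order _ _ fun i hi => ?_
      exact congrFun h ⟨i, hi⟩
    · intro h
      ext i
      exact PowerSeries.coeff_of_lt_order _ (lt_of_lt_of_le (by exact_mod_cast i.2) h)
  have h2 := LinearMap.quotKerEquivOfSurjective g hg
  rw [hker] at h2
  have e1 : (ℂ⟦X⟧ ⧸ Ideal.span {a}) ≃ₗ[ℂ] (Fin n → ℂ) := h2
  rw [e1.length_eq, Module.length_eq_finrank, Module.finrank_fin_fun, hn]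

/-- The length of the cokernel of an injective endomorphism is the order of the determinant. -/
lemma length_quotient_range {J M N : Type*} [Fintype J] [DecidableEq J] [AddCommGroup M]
    [AddCommGroup N] [Module ℂ⟦X⟧ M] [Module ℂ⟦X⟧ N] [Module ℂ N] [IsScalarTower ℂ ℂ⟦X⟧ N]
    (bM : Module.Basis J ℂ⟦X⟧ M) (bN : Module.Basis J ℂ⟦X⟧ N) (f : M →ₗ[ℂ⟦X⟧] N)
    (hf : (LinearMap.toMatrix bM bN f).det ≠ 0) :
    Module.length ℂ (N ⧸ LinearMap.range f) = (LinearMap.toMatrix bM bN f).det.order := by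
  have hinj : Function.Injective f := by
    rw [← LinearMap.ker_eq_bot, LinearMap.ker_eq_bot']
    intro m hm
    have h1 := LinearMap.toMatrix_mulVec_repr bM bN f m
    rw [hm, map_zero, Finsupp.coe_zero] at h1
    have h2 := Matrix.eq_zero_of_mulVec_eq_zero hf h1
    exact bM.repr.map_eq_zero_iff.1 (DFunLike.coe_injective h2)
  let e : M ≃ₗ[ℂ⟦X⟧] LinearMap.range f := LinearEquiv.ofInjective f hinj
  have hr : Module.finrank ℂ⟦X⟧ (LinearMap.range f) = Module.finrank ℂ⟦X⟧ N := by
    rw [← e.finrank_eq, Module.finrank_eq_card_basis bM, Module.finrank_eq_card_basis bN]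
  have E := (Submodule.quotientEquivPiSpan _ bN hr).restrictScalars ℂ
  set a := Submodule.smithNormalFormCoeffs bN hr with ha
  set b' := Submodule.smithNormalFormTopBasis bN hr
  set ab := Submodule.smithNormalFormBotBasis bN hr
  have ha0 : ∀ i, a i ≠ 0 := Submodule.smithNormalFormCoeffs_ne_zero bN hr
  have hmat : LinearMap.toMatrix bM bN f =
      LinearMap.toMatrix b' bN LinearMap.id * Matrix.diagonal a * LinearMap.toMatrix bM ab e := by
    have h1 : LinearMap.toMatrix ab b' (LinearMap.range f).subtype = Matrix.diagonal a := by
      ext i j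
      rw [LinearMap.toMatrix_apply, Submodule.subtype_apply,
        Submodule.smithNormalFormBotBasis_def, map_smul, Module.Basis.repr_self,
        Matrix.diagonal_apply]
      simp only [Finsupp.smul_apply, Finsupp.single_apply, smul_eq_mul, mul_ite, mul_one, mul_zero]
      rcases eq_or_ne i j with rfl | h
      · simp [ha]
      · simp [h, h.symm]
    rw [← h1, ← LinearMap.toMatrix_comp, ← LinearMap.toMatrix_comp]
    congr 1
  have hu1 : IsUnit (LinearMap.toMatrix b' bN LinearMap.id).det :=
    LinearEquiv.isUnit_det (LinearEquiv.refl ℂ⟦X⟧ N) b' bN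
  have hu2 : IsUnit (LinearMap.toMatrix bM ab e).det := LinearEquiv.isUnit_det e bM ab
  rw [hmat, Matrix.det_mul, Matrix.det_mul, PowerSeries.order_mul, PowerSeries.order_mul,
    PowerSeries.order_zero_of_unit hu1, PowerSeries.order_zero_of_unit hu2, zero_add, add_zero,
    Matrix.det_diagonal, E.length_eq, Module.length_pi_of_fintype, PowerSeries.order_prod]
  exact Finset.sum_congr rfl fun i _ => length_quotient_span_singleton (ha0 i)

/-- The length of `ℂ⟦x⟧[Y] / (Q, g)` is the order of the resultant. -/
lemma length_quotient_span_pair {Q g : ℂ⟦X⟧[X]} (hQ : Q.Monic) (h : Q.resultant g ≠ 0) :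
    Module.length ℂ (ℂ⟦X⟧[X] ⧸ Ideal.span {Q, g}) = (Q.resultant g).order := by
  set m := Q.natDegree with hm
  set n := g.natDegree with hn
  let S := Polynomial.sylvesterMap (m := m) (n := n) Q g le_rfl le_rfl
  have hdet : (LinearMap.toMatrix
      (((Polynomial.degreeLT.basis _ _).prod (Polynomial.degreeLT.basis _ _)).reindex
        finSumFinEquiv) (Polynomial.degreeLT.basis _ _) S).det = Q.resultant g := by
    rw [Polynomial.toMatrix_sylvesterMap']; rfl
  rw [← hdet, ← length_quotient_range _ _ S (by rwa [hdet])]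
  let π : Polynomial.degreeLT ℂ⟦X⟧ (m + n) →ₗ[ℂ⟦X⟧] (ℂ⟦X⟧[X] ⧸ Ideal.span {Q, g}) :=
    (Ideal.Quotient.mkₐ ℂ⟦X⟧ (Ideal.span {Q, g})).toLinearMap ∘ₗ Submodule.subtype _
  have hsurj : Function.Surjective π := by
    intro x
    obtain ⟨x, rfl⟩ := Ideal.Quotient.mk_surjective x
    refine ⟨⟨x %ₘ Q, ?_⟩, ?_⟩
    · rw [Polynomial.mem_degreeLT]
      refine (Polynomial.degree_modByMonic_lt x hQ).trans_le ?_
      rw [Polynomial.degree_eq_natDegree hQ.ne_zero]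
      exact_mod_cast Nat.le_add_right _ _
    · refine (Ideal.Quotient.mk_eq_mk_iff_sub_mem _ _).2 ?_
      have : x %ₘ Q - x = Q * (-(x /ₘ Q)) := by
        linear_combination Polynomial.modByMonic_add_div x Q
      change x %ₘ Q - x ∈ _
      rw [this]
      exact Ideal.mul_mem_right _ _ (Ideal.subset_span (by simp))
  have hker : LinearMap.ker π = LinearMap.range S := by
    ext ⟨p, hp⟩
    have h1 : (⟨p, hp⟩ ∈ LinearMap.ker π) ↔ p ∈ Ideal.span {Q, g} := Ideal.Quotient.eq_zero_iff_mem
    rw [h1, Ideal.mem_span_pair, LinearMap.mem_range]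
    constructor
    · rintro ⟨a, b, hab⟩
      set b' := b %ₘ Q with hb'
      set a' := a + g * (b /ₘ Q) with ha'
      have hab' : Q * a' + g * b' = p := by
        rw [← hab]
        linear_combination g * Polynomial.modByMonic_add_div b Q
      have hbdeg : b'.degree < m := by
        rw [hm, ← Polynomial.degree_eq_natDegree hQ.ne_zero]
        exact Polynomial.degree_modByMonic_lt b hQ
      have hadeg : a'.degree < n := by
        by_contra hcon
        rw [not_lt] at hcon
        have hp' := Polynomial.mem_degreeLT.1 hp
        have h3 : (Q * a').degree < ((m + n : ℕ) : WithBot ℕ) := by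
          have : Q * a' = p - g * b' := by linear_combination hab'
          rw [this]
          refine (Polynomial.degree_sub_le _ _).trans_lt (max_lt hp' ?_)
          rcases eq_or_ne g 0 with h0 | h0
          · rw [h0, zero_mul, Polynomial.degree_zero]; exact WithBot.bot_lt_coe _
          · rw [Polynomial.degree_mul, Polynomial.degree_eq_natDegree h0, Nat.cast_add, add_comm]
            exact WithBot.add_lt_add_of_lt_of_le (by simp) hbdeg le_rfl
        rw [Polynomial.degree_mul, Polynomial.degree_eq_natDegree hQ.ne_zero, Nat.cast_add] at h3
        exact absurd h3 (not_lt.2 (add_le_add le_rfl hcon))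
      refine ⟨(⟨b', Polynomial.mem_degreeLT.2 hbdeg⟩, ⟨a', Polynomial.mem_degreeLT.2 hadeg⟩), ?_⟩
      exact Subtype.ext hab'
    · rintro ⟨⟨⟨b, hb⟩, ⟨a, ha⟩⟩, hab⟩
      refine ⟨a, b, ?_⟩
      have := congrArg Subtype.val hab
      rw [mul_comm a, mul_comm b]
      exact this
  have e0 := LinearMap.quotKerEquivOfSurjective (R := ℂ⟦X⟧)
    (M := Polynomial.degreeLT ℂ⟦X⟧ (m + n)) (M₂ := ℂ⟦X⟧[X] ⧸ Ideal.span {Q, g}) π hsurj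
  rw [hker] at e0
  exact ((e0.restrictScalars ℂ).length_eq).symm

lemma ENat.nsmul_left_cancel {n : ℕ} (hn : n ≠ 0) {a b : ℕ∞} (h : n • a = n • b) : a = b := by
  rw [nsmul_eq_mul, nsmul_eq_mul] at h
  induction a using ENat.recTopCoe with
  | top =>
    induction b using ENat.recTopCoe with
    | top => rfl
    | coe b =>
      rw [ENat.mul_top (by exact_mod_cast hn)] at h
      exact absurd h.symm (by exact_mod_cast ENat.natCast_ne_top (n * b))
  | coe a =>
    induction b using ENat.recTopCoe with
    | top =>
      rw [ENat.mul_top (by exact_mod_cast hn)] at h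
      exact absurd h (by exact_mod_cast ENat.natCast_ne_top (n * a))
    | coe b =>
      have : n * a = n * b := by exact_mod_cast h
      exact_mod_cast Nat.eq_of_mul_eq_mul_left (Nat.pos_of_ne_zero hn) this

lemma order_expandHom {m : ℕ} (hm : m ≠ 0) (a : ℂ⟦X⟧) : (expandHom m hm a).order = m • a.order :=
  PowerSeries.order_expand m hm a

lemma order_rescale {c : ℂ} (hc : c ≠ 0) (a : ℂ⟦X⟧) :
    (PowerSeries.rescale c a).order = a.order := by
  have key : ∀ {c : ℂ}, c ≠ 0 → ∀ a : ℂ⟦X⟧, a.order ≤ (PowerSeries.rescale c a).order := by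
    intro c hc a
    refine PowerSeries.le_order _ _ fun i hi => ?_
    rw [PowerSeries.coeff_rescale, PowerSeries.coeff_of_lt_order i hi, mul_zero]
  refine le_antisymm ?_ (key hc a)
  have := key (inv_ne_zero hc) (PowerSeries.rescale c a)
  rwa [PowerSeries.rescale_rescale, mul_inv_cancel₀ hc, PowerSeries.rescale_one] at this

namespace PuiseuxBranch

lemma expandHom_resultant (B : PuiseuxBranch) (g : ℂ⟦X⟧[X]) :
    expandHom B.deg B.deg_ne (B.poly.resultant g) =
      ∏ k : Fin B.deg, PowerSeries.rescale (stdRoot B.deg ^ (k : ℕ)) (B.eval g) := by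
  rw [← Polynomial.resultant_map_map, ← B.monic.natDegree_map (expandHom B.deg B.deg_ne),
    B.map_poly, Polynomial.resultant_prod_left _ _ _ _ (by simp) Polynomial.natDegree_map_le]
  refine Finset.prod_congr rfl fun k _ => ?_
  rw [Polynomial.natDegree_X_sub_C,
    Polynomial.resultant_X_sub_C_left _ _ _ Polynomial.natDegree_map_le, Polynomial.eval_map,
    eval₂_expandHom_rescale, eval_apply]
  rw [← pow_mul, mul_comm, pow_mul, (stdRoot_isPrimitiveRoot B.deg_ne).pow_eq_one, one_pow]

lemma order_resultant (B : PuiseuxBranch) (g : ℂ⟦X⟧[X]) :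
    (B.poly.resultant g).order = (B.eval g).order := by
  have h := congrArg PowerSeries.order (B.expandHom_resultant g)
  rw [order_expandHom, PowerSeries.order_prod, Finset.sum_congr rfl fun k _ =>
    order_rescale (pow_ne_zero _ ((stdRoot_isPrimitiveRoot B.deg_ne).ne_zero B.deg_ne)) (B.eval g),
    Finset.sum_const, Finset.card_univ, Fintype.card_fin] at h
  exact ENat.nsmul_left_cancel B.deg_ne h

lemma monic_list_prod (l : List PuiseuxBranch) : (l.map poly).prod.Monic := by
  induction l with
  | nil => simp
  | cons B l ih => rw [List.map_cons, List.prod_cons]; exact B.monic.mul ih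

lemma order_resultant_list_prod (l : List PuiseuxBranch) (g : ℂ⟦X⟧[X]) :
    ((l.map poly).prod.resultant g).order = (l.map fun B => (B.eval g).order).sum := by
  induction l with
  | nil => simp
  | cons B l ih =>
    rw [List.map_cons, List.prod_cons, List.map_cons, List.sum_cons, ← ih, ← B.order_resultant,
      B.monic.natDegree_mul (monic_list_prod l), Polynomial.resultant_mul_left _ _ _ _ le_rfl,
      PowerSeries.order_mul]

/-- The length of `ℂ⟦x⟧[Y] / (Q, g)` is the intersection multiplicity, computed branchwise. -/
theorem length_quotient_list (l : List PuiseuxBranch) (g : ℂ⟦X⟧[X])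
    (h : ∀ B ∈ l, B.eval g ≠ 0) :
    Module.length ℂ (ℂ⟦X⟧[X] ⧸ Ideal.span {(l.map poly).prod, g}) =
      (l.map fun B => (B.eval g).order).sum := by
  rw [← order_resultant_list_prod, length_quotient_span_pair (monic_list_prod l)]
  rw [Ne, ← PowerSeries.order_eq_top, order_resultant_list_prod]
  induction l with
  | nil => simp
  | cons B l ih =>
    rw [List.map_cons, List.sum_cons, ENat.add_eq_top, not_or]
    refine ⟨mt PowerSeries.order_eq_top.1 (h B (by simp)), ih fun B' hB' => h B' (by simp [hB'])⟩

end PuiseuxBranch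

lemma Matrix.det_of_sigma_blocks {R : Type*} [CommRing R] {r : ℕ} {d : Fin r → ℕ}
    (V : ∀ i, Matrix (Fin (d i)) (Fin (d i)) R)
    (M : Matrix (Σ i, Fin (d i)) (Σ i, Fin (d i)) R)
    (h1 : ∀ i k l, M ⟨i, k⟩ ⟨i, l⟩ = V i k l)
    (h2 : ∀ a b, a.1 ≠ b.1 → M a b = 0) : M.det = ∏ i, (V i).det := by
  have hM : M.BlockTriangular Sigma.fst := fun a b hab => h2 a b hab.ne'
  rw [hM.det_fintype]
  refine Finset.prod_congr rfl fun i _ => ?_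
  rw [← Matrix.det_submatrix_equiv_self (Equiv.sigmaSubtype (β := fun i => Fin (d i)) i) (V i)]
  congr 1
  ext ⟨⟨a, k⟩, rfl⟩ ⟨⟨b, l⟩, hb⟩
  obtain rfl : a = b := hb.symm
  exact h1 _ _ _

/-- Twice the order of a Vandermonde determinant. -/
lemma two_nsmul_order_det_vandermonde {J : Type*} [Fintype J] [DecidableEq J] {n : ℕ}
    (e : J ≃ Fin n) (z : J → ℂ⟦X⟧) :
    2 • (Matrix.det (Matrix.of fun a b : J => z a ^ (e b : ℕ))).order =
      ∑ a, ∑ b ∈ Finset.univ.erase a, (z a - z b).order := by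
  have h1 : (Matrix.of fun a b : J => z a ^ (e b : ℕ)) =
      (Matrix.vandermonde (z ∘ e.symm)).submatrix e e := by
    ext a b; simp [Matrix.vandermonde]
  rw [h1, Matrix.det_submatrix_equiv_self, Matrix.det_vandermonde, PowerSeries.order_prod]
  simp_rw [PowerSeries.order_prod]
  have h2 := Finset.sum_sum_Ioi_add_eq_sum_sum_off_diag
    (fun i j : Fin n => ((z ∘ e.symm) i - (z ∘ e.symm) j).order)
  have h3 : ∀ i j : Fin n, ((z ∘ e.symm) i - (z ∘ e.symm) j).order =
      ((z ∘ e.symm) j - (z ∘ e.symm) i).order := by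
    intro i j; rw [← PowerSeries.order_neg, neg_sub]
  simp_rw [h3 _ _] at h2
  rw [two_nsmul, ← Finset.sum_add_distrib]
  simp_rw [← Finset.sum_add_distrib]
  refine Eq.trans ?_ (h2.trans ?_)
  · refine Finset.sum_congr rfl fun i _ => Finset.sum_congr rfl fun j _ => ?_
    rw [h3 i j]
  · refine Fintype.sum_equiv e.symm _ _ fun i => ?_
    refine Finset.sum_bij (fun j _ => e.symm j) ?_ ?_ ?_ ?_
    · intro j hj
      simpa using hj
    · intro a _ b _ h; exact e.symm.injective h
    · intro b hb
      refine ⟨e b, ?_, by simp⟩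
      simp only [Finset.mem_erase, Finset.mem_univ, and_true, Finset.mem_compl,
        Finset.mem_singleton] at hb ⊢
      rintro rfl
      simp at hb
    · intro j _; rfl

namespace PuiseuxBranch

variable {r : ℕ} (B : Fin r → PuiseuxBranch)

/-- Pullback of functions to the disjoint union of the normalized branches. -/
def evalPi : ℂ⟦X⟧[X] →ₐ[ℂ] (Fin r → ℂ⟦X⟧) :=
  { RingHom.pi fun i => (B i).eval with
    commutes' := by
      intro c
      ext1 i
      change (B i).eval (algebraMap ℂ ℂ⟦X⟧[X] c) = _
      rw [Polynomial.algebraMap_apply, eval_C]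
      exact (PowerSeries.expand (B i).deg (B i).deg_ne : ℂ⟦X⟧ →ₐ[ℂ] ℂ⟦X⟧).commutes c }

lemma evalPi_apply (g : ℂ⟦X⟧[X]) (i : Fin r) : evalPi B g i = (B i).eval g := rfl

/-- The index set of a basis of `∏ ℂ⟦t⟧` over `ℂ⟦x⟧`. -/
abbrev Idx : Type := Σ i, Fin (B i).deg

/-- Coordinates of an element of `∏ ℂ⟦t⟧` with respect to the monomial basis over `ℂ⟦x⟧`. -/
def glue : (Idx B → ℂ⟦X⟧) ≃ₗ[ℂ] (Fin r → ℂ⟦X⟧) where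
  toFun a i := ∑ l : Fin (B i).deg,
    PowerSeries.X ^ (l : ℕ) * expandHom (B i).deg (B i).deg_ne (a ⟨i, l⟩)
  map_add' a b := by
    ext1 i
    simp only [Pi.add_apply, map_add, mul_add, Finset.sum_add_distrib]
  map_smul' c a := by
    ext1 i
    simp only [Pi.smul_apply, RingHom.id_apply, Finset.smul_sum, expandHom, RingHom.coe_coe,
      map_smul, mul_smul_comm]
  invFun f a := PowerSeries.mk fun s => PowerSeries.coeff ((B a.1).deg * s + a.2) (f a.1)
  left_inv := by
    intro a
    ext ⟨i, k⟩ s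
    rw [PowerSeries.coeff_mk, map_sum, Finset.sum_eq_single k]
    · simp only [expandHom, RingHom.coe_coe]
      rw [PowerSeries.coeff_X_pow_mul, PowerSeries.coeff_expand_mul]
    · intro l _ hl
      simp only [expandHom, RingHom.coe_coe]
      rw [PowerSeries.coeff_X_pow_mul']
      split_ifs with h
      · rw [PowerSeries.coeff_expand, if_neg]
        intro hd
        apply hl
        have h2 : (B i).deg * s + k ≡ l [MOD (B i).deg] := ((Nat.modEq_iff_dvd' h).2 hd).symm
        have h3 : (k : ℕ) ≡ l [MOD (B i).deg] := by
          refine Nat.ModEq.trans ?_ h2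
          simp [Nat.ModEq]
        exact (Fin.ext (Nat.ModEq.eq_of_lt_of_lt h3 k.2 l.2)).symm
      · rfl
    · simp
  right_inv := by
    intro f
    ext i s
    have hpos := Nat.pos_of_ne_zero (B i).deg_ne
    rw [map_sum, Finset.sum_eq_single ⟨s % (B i).deg, Nat.mod_lt _ hpos⟩]
    · simp only [expandHom, RingHom.coe_coe]
      have h := Nat.div_add_mod s (B i).deg
      have h' : ∀ p : ℂ⟦X⟧, PowerSeries.coeff s p =
          PowerSeries.coeff ((B i).deg * (s / (B i).deg) + s % (B i).deg) p := by
        intro p; rw [h]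
      rw [h', PowerSeries.coeff_X_pow_mul, PowerSeries.coeff_expand_mul, PowerSeries.coeff_mk, h]
    · intro l _ hl
      simp only [expandHom, RingHom.coe_coe]
      rw [PowerSeries.coeff_X_pow_mul']
      split_ifs with h
      · rw [PowerSeries.coeff_expand, if_neg]
        intro hd
        apply hl
        apply Fin.ext
        have h2 : l ≡ s [MOD (B i).deg] := ((Nat.modEq_iff_dvd' h).2 hd)
        change (l : ℕ) = s % _
        rw [← h2, Nat.mod_eq_of_lt l.2]
      · rfl
    · simp

lemma glue_apply (a : Idx B → ℂ⟦X⟧) (i : Fin r) : glue B a i = ∑ l : Fin (B i).deg,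
    PowerSeries.X ^ (l : ℕ) * expandHom (B i).deg (B i).deg_ne (a ⟨i, l⟩) := rfl

/-- A numbering of the monomial basis. -/
def idxEquiv : Idx B ≃ Fin (Fintype.card (Idx B)) := Fintype.equivFin _

/-- The matrix over `ℂ⟦x⟧` expressing `1, Y, Y², …` in terms of the monomial basis. -/
def powMatrix : Matrix (Idx B) (Idx B) ℂ⟦X⟧ :=
  Matrix.of fun a b => (glue B).symm (fun i => (B i).param ^ (idxEquiv B b : ℕ)) a

lemma sum_powMatrix (i : Fin r) (b : Idx B) :
    ∑ l : Fin (B i).deg, PowerSeries.X ^ (l : ℕ) *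
      expandHom (B i).deg (B i).deg_ne (powMatrix B ⟨i, l⟩ b) =
      (B i).param ^ (idxEquiv B b : ℕ) := by
  have h := congrFun ((glue B).apply_symm_apply
    (fun i => (B i).param ^ (idxEquiv B b : ℕ))) i
  rw [glue_apply] at h
  exact h

lemma glue_mulVec (a : Idx B → ℂ⟦X⟧) :
    glue B ((powMatrix B).mulVec a) =
      evalPi B (∑ b, Polynomial.C (a b) * Polynomial.X ^ (idxEquiv B b : ℕ)) := by
  ext1 i
  rw [glue_apply, evalPi_apply, map_sum]
  simp_rw [Matrix.mulVec, dotProduct, map_sum, Finset.mul_sum]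
  rw [Finset.sum_comm]
  refine Finset.sum_congr rfl fun b _ => ?_
  rw [map_mul, map_pow, eval_C, eval_X, ← sum_powMatrix, Finset.mul_sum]
  refine Finset.sum_congr rfl fun l _ => ?_
  rw [map_mul]; ring

lemma card_idx : Fintype.card (Idx B) = ∑ i, (B i).deg := by
  simp [Idx, Fintype.card_sigma]

/-- The product of the polynomials of the branches. -/
def prodPoly : ℂ⟦X⟧[X] := ∏ i, (B i).poly

lemma monic_prodPoly : (prodPoly B).Monic :=
  Polynomial.monic_prod_of_monic _ _ fun i _ => (B i).monic

lemma natDegree_prodPoly : (prodPoly B).natDegree = Fintype.card (Idx B) := by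
  rw [card_idx, prodPoly, Polynomial.natDegree_prod_of_monic _ _ fun i _ => (B i).monic]
  simp_rw [natDegree_poly]

lemma evalPi_prodPoly : evalPi B (prodPoly B) = 0 := by
  ext1 i
  rw [evalPi_apply]
  exact (B i).eval_eq_zero_iff.2 (Finset.dvd_prod_of_mem _ (Finset.mem_univ i))

lemma map_range_mulVec :
    Submodule.map (glue B : (Idx B → ℂ⟦X⟧) →ₗ[ℂ] (Fin r → ℂ⟦X⟧))
      ((LinearMap.range (Matrix.toLin' (powMatrix B))).restrictScalars ℂ) =
      LinearMap.range (evalPi B).toLinearMap := by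
  ext f
  constructor
  · rintro ⟨_, ⟨a, rfl⟩, rfl⟩
    rw [Matrix.toLin'_apply]
    exact ⟨_, (glue_mulVec B a).symm⟩
  · rintro ⟨g, rfl⟩
    set P := prodPoly B with hP
    set g' := g %ₘ P with hg'
    have h1 : evalPi B g = evalPi B g' := by
      conv_lhs => rw [← Polynomial.modByMonic_add_div g P]
      rw [map_add, map_mul, evalPi_prodPoly, zero_mul, add_zero]
    refine ⟨(powMatrix B).mulVec fun b => g'.coeff (idxEquiv B b), ⟨_, rfl⟩, ?_⟩
    refine (glue_mulVec B _).trans (Eq.trans ?_ h1.symm)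
    congr 1
    rw [Fintype.sum_equiv (idxEquiv B) _ (fun j : Fin (Fintype.card (Idx B)) =>
      Polynomial.C (g'.coeff j) * Polynomial.X ^ (j : ℕ)) (fun _ => rfl),
      Fin.sum_univ_eq_sum_range (fun j => Polynomial.C (g'.coeff j) * Polynomial.X ^ j)]
    rcases eq_or_ne g' 0 with h0 | h0
    · simp [h0]
    · refine (g'.as_sum_range_C_mul_X_pow' ?_).symm
      rw [Polynomial.natDegree_lt_iff_degree_lt h0, ← natDegree_prodPoly,
        ← Polynomial.degree_eq_natDegree (monic_prodPoly B).ne_zero]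
      exact Polynomial.degree_modByMonic_lt g (monic_prodPoly B)

lemma length_quotient_range_evalPi (h : (powMatrix B).det ≠ 0) :
    Module.length ℂ ((Fin r → ℂ⟦X⟧) ⧸ LinearMap.range (evalPi B).toLinearMap) =
      (powMatrix B).det.order := by
  have h1 := length_quotient_range (Pi.basisFun ℂ⟦X⟧ (Idx B)) (Pi.basisFun ℂ⟦X⟧ (Idx B))
    (Matrix.toLin' (powMatrix B)) (by
      rwa [LinearMap.toMatrix_eq_toMatrix', LinearMap.toMatrix'_toLin'])
  rw [LinearMap.toMatrix_eq_toMatrix', LinearMap.toMatrix'_toLin'] at h1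
  rw [← h1]
  exact (Submodule.Quotient.equiv _ _ (glue B) (map_range_mulVec B)).length_eq.symm
end PuiseuxBranch

namespace PuiseuxBranch

variable {r : ℕ} (B : Fin r → PuiseuxBranch)

/-- The product of the degrees of the branches. -/
def totDeg : ℕ := ∏ i, (B i).deg

/-- The product of the degrees of the other branches. -/
def coDeg (i : Fin r) : ℕ := ∏ j ∈ Finset.univ.erase i, (B j).deg

lemma totDeg_ne : totDeg B ≠ 0 := Finset.prod_ne_zero_iff.2 fun i _ => (B i).deg_ne

lemma coDeg_ne (i : Fin r) : coDeg B i ≠ 0 := Finset.prod_ne_zero_iff.2 fun i _ => (B i).deg_ne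

lemma deg_mul_coDeg (i : Fin r) : (B i).deg * coDeg B i = totDeg B :=
  Finset.mul_prod_erase _ (fun i => (B i).deg) (Finset.mem_univ i)

/-- The embeddings of the coordinate rings of the normalized branches into a common cover of the
`x`-axis. -/
def conj (a : Idx B) : ℂ⟦X⟧ →+* ℂ⟦X⟧ :=
  (expandHom (coDeg B a.1) (coDeg_ne B a.1)).comp
    (PowerSeries.rescale (stdRoot (B a.1).deg ^ (a.2 : ℕ)))

lemma conj_apply (a : Idx B) (f : ℂ⟦X⟧) : conj B a f =
    expandHom (coDeg B a.1) (coDeg_ne B a.1)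
      (PowerSeries.rescale (stdRoot (B a.1).deg ^ (a.2 : ℕ)) f) := rfl

lemma stdRoot_pow_ne_zero {n : ℕ} (hn : n ≠ 0) (k : ℕ) : stdRoot n ^ k ≠ 0 :=
  pow_ne_zero _ ((stdRoot_isPrimitiveRoot hn).ne_zero hn)

lemma order_conj (a : Idx B) (f : ℂ⟦X⟧) : (conj B a f).order = coDeg B a.1 • f.order := by
  rw [conj_apply, order_expandHom, order_rescale (stdRoot_pow_ne_zero (B a.1).deg_ne _)]

lemma conj_injective (a : Idx B) : Function.Injective (conj B a) := by
  rw [injective_iff_map_eq_zero]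
  intro f h
  rw [conj_apply, map_eq_zero_iff _ (expandHom_injective _),
    rescale_eq_zero_iff (stdRoot_pow_ne_zero (B a.1).deg_ne _)] at h
  exact h

lemma expandHom_totDeg (i : Fin r) (f : ℂ⟦X⟧) : expandHom (totDeg B) (totDeg_ne B) f =
    expandHom (coDeg B i) (coDeg_ne B i) (expandHom (B i).deg (B i).deg_ne f) := by
  simp only [expandHom, RingHom.coe_coe]
  rw [← PowerSeries.expand_mul]
  simp only [← deg_mul_coDeg B i, mul_comm]

lemma conj_expandHom (a : Idx B) (f : ℂ⟦X⟧) :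
    conj B a (expandHom (B a.1).deg (B a.1).deg_ne f) =
      expandHom (totDeg B) (totDeg_ne B) f := by
  rw [conj_apply, rescale_expandHom, ← pow_mul, mul_comm, pow_mul,
    (stdRoot_isPrimitiveRoot (B a.1).deg_ne).pow_eq_one, one_pow, PowerSeries.rescale_one,
    RingHom.id_apply, ← expandHom_totDeg]

/-- All the Puiseux series, over a common cover of the `x`-axis. -/
def root (a : Idx B) : ℂ⟦X⟧ := conj B a (B a.1).param

lemma eval_root (a : Idx B) (g : ℂ⟦X⟧[X]) :
    (g.map (expandHom (totDeg B) (totDeg_ne B))).eval (root B a) = conj B a ((B a.1).eval g) := by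
  rw [eval_apply, Polynomial.hom_eval₂, Polynomial.eval_map]
  congr 1
  ext1 f
  exact (conj_expandHom B a f).symm

lemma map_prodPoly : (prodPoly B).map (expandHom (totDeg B) (totDeg_ne B)) =
    ∏ a, (Polynomial.X - Polynomial.C (root B a)) := by
  rw [prodPoly, Polynomial.map_prod, Fintype.prod_sigma]
  refine Finset.prod_congr rfl fun i _ => ?_
  have : expandHom (totDeg B) (totDeg_ne B) = (expandHom (coDeg B i) (coDeg_ne B i)).comp
      (expandHom (B i).deg (B i).deg_ne) := RingHom.ext (expandHom_totDeg B i)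
  rw [this, ← Polynomial.map_map, (B i).map_poly, Polynomial.map_prod]
  refine Finset.prod_congr rfl fun k _ => ?_
  rw [Polynomial.map_sub, Polynomial.map_X, Polynomial.map_C]
  rfl

lemma conj_derivative (a : Idx B) :
    conj B a ((B a.1).eval (Polynomial.derivative (prodPoly B))) =
      ∏ b ∈ Finset.univ.erase a, (root B a - root B b) := by
  classical
  rw [← eval_root, ← Polynomial.derivative_map, map_prodPoly, Polynomial.derivative_prod_finset,
    Polynomial.eval_finsetSum, Finset.sum_eq_single a]
  · simp [Polynomial.eval_prod]
  · intro b _ hb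
    rw [Polynomial.eval_mul, Polynomial.eval_prod,
      Finset.prod_eq_zero (Finset.mem_erase.2 ⟨hb.symm, Finset.mem_univ a⟩) (by simp), zero_mul]
  · simp

variable {B}

lemma root_injective (hB : Function.Injective fun i => (B i).poly) :
    Function.Injective (root B) := by
  rintro a b h
  have key : ∀ a b, root B a = root B b → (B a.1).poly ∣ (B b.1).poly := by
    intro a b h
    have h1 := eval_root B b (B b.1).poly
    rw [(B b.1).eval_eq_zero_iff.2 dvd_rfl, map_zero, ← h, eval_root,
      map_eq_zero_iff _ (conj_injective B a)] at h1
    exact (B a.1).eval_eq_zero_iff.1 h1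
  have h1 : (B a.1).poly = (B b.1).poly :=
    Polynomial.eq_of_monic_of_associated (B a.1).monic (B b.1).monic
      (associated_of_dvd_dvd (key a b h) (key b a h.symm))
  obtain ⟨i, k⟩ := a
  obtain ⟨j, l⟩ := b
  obtain rfl : i = j := hB h1
  obtain rfl : k = l := (B i).injective (expandHom_injective (coDeg_ne B i) h)
  rfl

lemma eval_derivative_ne_zero (hB : Function.Injective fun i => (B i).poly) (i : Fin r) :
    (B i).eval (Polynomial.derivative (prodPoly B)) ≠ 0 := by
  intro h
  have h1 := conj_derivative B ⟨i, ⟨0, Nat.pos_of_ne_zero (B i).deg_ne⟩⟩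
  rw [h, map_zero] at h1
  obtain ⟨b, hb, hb'⟩ := Finset.prod_eq_zero_iff.1 h1.symm
  exact (Finset.mem_erase.1 hb).1 (root_injective hB (sub_eq_zero.1 hb')).symm

lemma two_nsmul_order_det_root :
    2 • (Matrix.det (Matrix.of fun a b : Idx B => root B a ^ (idxEquiv B b : ℕ))).order =
      totDeg B • ∑ i, ((B i).eval (Polynomial.derivative (prodPoly B))).order := by
  rw [two_nsmul_order_det_vandermonde]
  rw [Finset.sum_congr rfl fun a _ => (by
    rw [← PowerSeries.order_prod, ← conj_derivative, order_conj] :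
    ∑ b ∈ Finset.univ.erase a, (root B a - root B b).order = coDeg B a.1 •
      ((B a.1).eval (Polynomial.derivative (prodPoly B))).order),
    Fintype.sum_sigma, Finset.smul_sum]
  refine Finset.sum_congr rfl fun i _ => ?_
  refine (Finset.sum_const (coDeg B i •
    ((B i).eval (Polynomial.derivative (prodPoly B))).order)).trans ?_
  rw [Finset.card_univ, Fintype.card_fin, ← mul_smul, deg_mul_coDeg]

variable (B) in
/-- The conjugates of the monomial basis. -/
def basisMatrix : Matrix (Idx B) (Idx B) ℂ⟦X⟧ :=
  Matrix.of fun a b => if a.1 = b.1 then conj B a PowerSeries.X ^ (b.2 : ℕ) else 0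

lemma basisMatrix_mul : basisMatrix B *
    (powMatrix B).map (expandHom (totDeg B) (totDeg_ne B)) =
      Matrix.of fun a b : Idx B => root B a ^ (idxEquiv B b : ℕ) := by
  ext1 a b
  obtain ⟨i, k⟩ := a
  rw [Matrix.mul_apply, Fintype.sum_sigma, Finset.sum_eq_single i]
  · simp only [basisMatrix, Matrix.of_apply, if_true, Matrix.map_apply]
    rw [root, ← map_pow, ← sum_powMatrix, map_sum]
    refine Finset.sum_congr rfl fun l _ => ?_
    rw [map_mul, map_pow, conj_expandHom B ⟨i, k⟩]
  · intro j _ hj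
    refine Finset.sum_eq_zero fun l _ => ?_
    simp [basisMatrix, hj.symm]
  · simp

lemma two_nsmul_order_det_basisMatrix :
    2 • (basisMatrix B).det.order + (totDeg B * r : ℕ) =
      (totDeg B * Fintype.card (Idx B) : ℕ) := by
  rw [Matrix.det_of_sigma_blocks (fun i => Matrix.of fun k l : Fin (B i).deg =>
    conj B ⟨i, k⟩ PowerSeries.X ^ ((Equiv.refl (Fin (B i).deg) l : Fin (B i).deg) : ℕ))
    (basisMatrix B)
    (fun i k l => by simp [basisMatrix]) (fun a b hab => by simp [basisMatrix, hab]),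
    PowerSeries.order_prod, Finset.smul_sum]
  have h : ∀ i, 2 • (Matrix.det (Matrix.of fun k l : Fin (B i).deg =>
      conj B ⟨i, k⟩ PowerSeries.X ^ ((Equiv.refl (Fin (B i).deg) l : Fin (B i).deg) : ℕ))).order =
      (totDeg B * ((B i).deg - 1) : ℕ) := by
    intro i
    rw [two_nsmul_order_det_vandermonde]
    have h1 : ∀ k : Fin (B i).deg, ∀ l ∈ Finset.univ.erase k,
        (conj B ⟨i, k⟩ PowerSeries.X - conj B ⟨i, l⟩ PowerSeries.X).order =
          (coDeg B i : ℕ∞) := by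
      intro k l hl
      have hkl := (Finset.mem_erase.1 hl).1
      rw [conj_apply, conj_apply, ← map_sub, order_expandHom]
      have h2 : PowerSeries.rescale (stdRoot (B i).deg ^ (k : ℕ)) (PowerSeries.X : ℂ⟦X⟧) -
          PowerSeries.rescale (stdRoot (B i).deg ^ (l : ℕ)) PowerSeries.X =
          PowerSeries.monomial 1 (stdRoot (B i).deg ^ (k : ℕ) - stdRoot (B i).deg ^ (l : ℕ)) := by
        ext s
        rw [map_sub, PowerSeries.coeff_rescale, PowerSeries.coeff_rescale, PowerSeries.coeff_X,
          PowerSeries.coeff_monomial]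
        split_ifs with hs
        · subst hs; simp
        · simp
      simp only
      rw [h2, PowerSeries.order_monomial_of_ne_zero]
      · simp
      · rw [sub_ne_zero]
        intro h3
        exact hkl (Fin.ext ((stdRoot_isPrimitiveRoot (B i).deg_ne).pow_inj k.2 l.2 h3)).symm
    rw [Finset.sum_congr rfl fun k _ => Finset.sum_congr rfl (h1 k)]
    simp only [Finset.sum_const, Finset.card_erase_of_mem (Finset.mem_univ _), Finset.card_univ,
      Fintype.card_fin]
    rw [← deg_mul_coDeg B i]
    push_cast [nsmul_eq_mul]
    ring
  rw [Finset.sum_congr rfl fun i _ => h i, card_idx]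
  norm_cast
  have h2 : totDeg B * r = ∑ i : Fin r, totDeg B := by simp [mul_comm]
  rw [h2, ← Finset.sum_add_distrib, Finset.mul_sum]
  refine Finset.sum_congr rfl fun i _ => ?_
  have := Nat.pos_of_ne_zero (B i).deg_ne
  rw [← Nat.mul_succ]
  congr 1
  omega

lemma det_powMatrix_ne_zero (hB : Function.Injective fun i => (B i).poly) :
    (powMatrix B).det ≠ 0 := by
  intro h
  have h1 := congrArg Matrix.det (basisMatrix_mul (B := B))
  rw [Matrix.det_mul, ← RingHom.mapMatrix_apply, ← RingHom.map_det, h, map_zero, mul_zero] at h1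
  have h2 := two_nsmul_order_det_root (B := B)
  rw [← h1, PowerSeries.order_zero, ← PowerSeries.order_prod] at h2
  have h3 : ∏ i, (B i).eval (Polynomial.derivative (prodPoly B)) ≠ 0 :=
    Finset.prod_ne_zero_iff.2 fun i _ => eval_derivative_ne_zero hB i
  have h4 := PowerSeries.order_eq_top.not.2 h3
  lift (∏ i, (B i).eval (Polynomial.derivative (prodPoly B))).order to ℕ using h4 with D hD
  norm_cast at h2

/-- The discriminant formula `D + r = 2 δ + N`. -/
theorem sum_order_derivative_add :
    ∑ i, ((B i).eval (Polynomial.derivative (prodPoly B))).order + r =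
      2 • (powMatrix B).det.order + Fintype.card (Idx B) := by
  have h1 := congrArg Matrix.det (basisMatrix_mul (B := B))
  rw [Matrix.det_mul, ← RingHom.mapMatrix_apply, ← RingHom.map_det] at h1
  have h2 := two_nsmul_order_det_root (B := B)
  rw [← h1, PowerSeries.order_mul, order_expandHom] at h2
  have h3 := two_nsmul_order_det_basisMatrix (B := B)
  refine ENat.nsmul_left_cancel (totDeg_ne B) ?_
  rw [smul_add, ← h2, smul_add, smul_add, ← mul_smul, ← mul_smul, mul_comm 2]
  push_cast at h3
  rw [nsmul_eq_mul (totDeg B) (r : ℕ∞), nsmul_eq_mul (totDeg B) (Fintype.card (Idx B) : ℕ∞), ← h3]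
  ring

end PuiseuxBranch

section Normalization

variable {O : Type} [CommRing O] [Algebra ℂ O] {r : ℕ} {φ : O →ₐ[ℂ] (Fin r → ℂ⟦X⟧)} {d : O}
  {s : (Fin r → ℂ⟦X⟧) → O}

lemma pi_ne_zero_of_mem_nonZeroDivisors (hφ : Function.Injective φ)
    (hd : ∀ i, φ d i ≠ 0) (hs : ∀ t, φ (s t) = φ d * t) {b : O} (hb : b ∈ nonZeroDivisors O)
    (i : Fin r) : φ b i ≠ 0 := by
  intro h
  have h1 : s (Pi.single i 1) * b = 0 := by
    apply hφ
    rw [map_mul, hs, map_zero]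
    ext1 j
    rcases eq_or_ne j i with rfl | hj
    · simp [h]
    · simp [hj]
  have h2 : s (Pi.single i 1) = 0 := (mem_nonZeroDivisors_iff.1 hb).2 _ h1
  have h3 := congrFun (hs (Pi.single i 1)) i
  rw [h2] at h3
  simp at h3
  exact hd i h3.symm

lemma mem_nonZeroDivisors_of_pi_ne_zero (hφ : Function.Injective φ)
    (hd : ∀ i, φ d i ≠ 0) : d ∈ nonZeroDivisors O := by
  rw [mem_nonZeroDivisors_iff_right]
  intro x hx
  apply hφ
  ext1 i
  have := congrFun (congrArg φ hx) i
  rw [map_mul, map_zero] at this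
  simpa [hd i] using this

lemma isIntegralElem_of_conductor [IsNoetherianRing O] (hφ : Function.Injective φ)
    (hd : ∀ i, φ d i ≠ 0) (hs : ∀ t, φ (s t) = φ d * t) (t : Fin r → ℂ⟦X⟧) :
    φ.toRingHom.IsIntegralElem t := by
  let _ := φ.toRingHom.toAlgebra
  have hsm : ∀ (a : O) (t : Fin r → ℂ⟦X⟧), a • t = φ a * t := fun a t => rfl
  let S : (Fin r → ℂ⟦X⟧) →ₗ[O] O :=
    { toFun := s
      map_add' := fun a b => hφ (by rw [map_add, hs, hs, hs, mul_add])
      map_smul' := fun a b => hφ (by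
        rw [hs, hsm, RingHom.id_apply, smul_eq_mul, map_mul, hs]; ring) }
  have hS : Function.Injective S := by
    intro t u h
    have h1 := congrArg φ (show s t = s u from h)
    rw [hs, hs] at h1
    ext1 i
    exact mul_left_cancel₀ (hd i) (congrFun h1 i)
  have : IsNoetherian O (Fin r → ℂ⟦X⟧) := isNoetherian_of_injective S hS
  have : Algebra.IsIntegral O (Fin r → ℂ⟦X⟧) := Algebra.IsIntegral.of_finite O _
  exact Algebra.IsIntegral.isIntegral t

/-- The normalization of a subring of a product of power series rings that contains a multiple
of the product. -/
theorem exists_equiv_integralClosure [IsNoetherianRing O] (hφ : Function.Injective φ)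
    (hd : ∀ i, φ d i ≠ 0) (hs : ∀ t, φ (s t) = φ d * t) :
    ∃ e : (Fin r → ℂ⟦X⟧) ≃ₗ[ℂ] integralClosure O (FractionRing O),
      ∀ o, e (φ o) = algebraMap O (integralClosure O (FractionRing O)) o := by
  have hdn := mem_nonZeroDivisors_of_pi_ne_zero hφ hd
  set K := FractionRing O
  have hdu : IsUnit (algebraMap O K d) := IsLocalization.map_units K ⟨d, hdn⟩
  have hKi : Function.Injective (algebraMap O K) := IsFractionRing.injective O K
  let ψ : (Fin r → ℂ⟦X⟧) → K := fun t => IsLocalization.mk' K (s t) ⟨d, hdn⟩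
  have hψ : ∀ t, algebraMap O K d * ψ t = algebraMap O K (s t) := fun t => by
    rw [mul_comm]; exact IsLocalization.mk'_spec K (s t) ⟨d, hdn⟩
  have hψu : ∀ t u, algebraMap O K d * u = algebraMap O K (s t) → ψ t = u := fun t u h =>
    hdu.mul_left_cancel ((hψ t).trans h.symm)
  have hψφ : ∀ o, ψ (φ o) = algebraMap O K o := fun o => hψu _ _ (by
    rw [← map_mul]; congr 1; apply hφ; rw [hs, map_mul])
  have hadd : ∀ t u, ψ (t + u) = ψ t + ψ u := fun t u => hψu _ _ (by
    rw [mul_add, hψ, hψ, ← map_add]; congr 1; apply hφ; rw [hs, map_add, hs, hs, mul_add])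
  have hmul : ∀ t u, ψ (t * u) = ψ t * ψ u := fun t u => hψu _ _ (by
    apply hdu.mul_left_cancel
    rw [show algebraMap O K d * (algebraMap O K d * (ψ t * ψ u)) =
      (algebraMap O K d * ψ t) * (algebraMap O K d * ψ u) by ring, hψ, hψ, ← map_mul, ← map_mul]
    congr 1; apply hφ; rw [map_mul, map_mul, hs, hs, hs]; ring)
  let Ψ : (Fin r → ℂ⟦X⟧) →+* K :=
    { toFun := ψ
      map_one' := by rw [← map_one φ, hψφ, map_one]
      map_mul' := hmul
      map_zero' := by rw [← map_zero φ, hψφ, map_zero]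
      map_add' := hadd }
  have hΨφ : Ψ.comp φ.toRingHom = algebraMap O K := RingHom.ext hψφ
  have hint : ∀ t, ψ t ∈ integralClosure O K := by
    intro t
    obtain ⟨p, hp, hp0⟩ := isIntegralElem_of_conductor hφ hd hs t
    refine ⟨p, hp, ?_⟩
    have := congrArg Ψ hp0
    rw [Polynomial.hom_eval₂, hΨφ, map_zero] at this
    exact this
  have hsmul : ∀ (c : ℂ) t, ψ (c • t) = c • ψ t := fun c t => by
    rw [Algebra.smul_def, hmul, ← φ.commutes, hψφ, ← IsScalarTower.algebraMap_apply,
      ← Algebra.smul_def]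
  let L : (Fin r → ℂ⟦X⟧) →ₗ[ℂ] integralClosure O K :=
    { toFun := fun t => ⟨ψ t, hint t⟩
      map_add' := fun t u => Subtype.ext (hadd t u)
      map_smul' := fun c t => Subtype.ext (hsmul c t) }
  have hLi : Function.Injective L := by
    intro t u h
    have h1 : ψ t = ψ u := congrArg Subtype.val h
    have h2 := hKi ((hψ t).symm.trans ((congrArg (algebraMap O K d * ·) h1).trans (hψ u)))
    have h3 := congrArg φ h2
    rw [hs, hs] at h3
    ext1 i
    exact mul_left_cancel₀ (hd i) (congrFun h3 i)
  have hLs : Function.Surjective L := by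
    rintro ⟨u, p, hp, hp0⟩
    obtain ⟨a, ⟨b, hb⟩, rfl⟩ := IsLocalization.exists_mk'_eq (nonZeroDivisors O) u
    have hbi := pi_ne_zero_of_mem_nonZeroDivisors hφ hd hs hb
    have hex : ∀ i, ∃ t : ℂ⟦X⟧, φ b i * t = φ a i := by
      intro i
      let F := FractionRing ℂ⟦X⟧
      let φi : O →+* ℂ⟦X⟧ := (Pi.evalRingHom (fun _ : Fin r => ℂ⟦X⟧) i).comp φ.toRingHom
      have hφi : ∀ o, φi o = φ o i := fun o => rfl
      have hun : ∀ y : nonZeroDivisors O, IsUnit (((algebraMap ℂ⟦X⟧ F).comp φi) y) := by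
        intro y
        rw [isUnit_iff_ne_zero, RingHom.comp_apply, Ne,
          map_eq_zero_iff _ (IsFractionRing.injective ℂ⟦X⟧ F)]
        exact pi_ne_zero_of_mem_nonZeroDivisors hφ hd hs y.2 i
      let χ : K →+* F := IsLocalization.lift hun
      have hχ : χ.comp (algebraMap O K) = (algebraMap ℂ⟦X⟧ F).comp φi :=
        IsLocalization.lift_comp hun
      set v := IsLocalization.mk' K a ⟨b, hb⟩ with hv
      have hχv : IsIntegral ℂ⟦X⟧ (χ v) := by
        refine ⟨p.map φi, hp.map _, ?_⟩
        rw [Polynomial.eval₂_map, ← hχ, ← Polynomial.hom_eval₂, hp0, map_zero]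
      obtain ⟨t, ht⟩ := IsIntegrallyClosed.isIntegral_iff.1 hχv
      refine ⟨t, IsFractionRing.injective ℂ⟦X⟧ F ?_⟩
      have h1 : v * algebraMap O K b = algebraMap O K a := IsLocalization.mk'_spec K a ⟨b, hb⟩
      have h2 := congrArg χ h1
      have h3 : ∀ o, χ (algebraMap O K o) = algebraMap ℂ⟦X⟧ F (φ o i) := fun o =>
        RingHom.congr_fun hχ o
      rw [map_mul, h3, h3, ← ht, ← map_mul, mul_comm] at h2
      exact h2
    choose t ht using hex
    refine ⟨t, Subtype.ext (hψu _ _ ?_)⟩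
    rw [← IsLocalization.mk'_mul_cancel_left (M := nonZeroDivisors O) (S := K) (s t) ⟨b, hb⟩,
      mul_comm, ← IsLocalization.mk'_one (M := nonZeroDivisors O) K d,
      ← IsLocalization.mk'_mul, mul_one]
    congr 1
    apply hφ
    rw [map_mul, map_mul, hs]
    ext1 i
    have := ht i
    simp only [Pi.mul_apply]
    rw [← this]; ring
  refine ⟨LinearEquiv.ofBijective L ⟨hLi, hLs⟩, fun o => Subtype.ext ?_⟩
  exact hψφ o

end Normalization

namespace PuiseuxBranch

variable {r : ℕ} {B : Fin r → PuiseuxBranch}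

lemma evalPi_eq_zero_iff (hB : Function.Injective fun i => (B i).poly) {g : ℂ⟦X⟧[X]} :
    evalPi B g = 0 ↔ prodPoly B ∣ g := by
  constructor
  · intro h
    refine Finset.prod_dvd_of_isRelPrime ?_ fun i _ => (B i).eval_eq_zero_iff.1 (congrFun h i)
    intro i _ j _ hij
    refine (((B i).poly_prime.irreducible.isRelPrime_iff_not_dvd).2 fun hd => hij (hB ?_))
    exact Polynomial.eq_of_monic_of_associated (B i).monic (B j).monic
      ((B i).poly_prime.irreducible.associated_of_dvd (B j).poly_prime.irreducible hd)
  · rintro ⟨q, rfl⟩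
    rw [map_mul, evalPi_prodPoly, zero_mul]

lemma exists_evalPi_eq_mul (t : Fin r → ℂ⟦X⟧) :
    ∃ g, evalPi B g = evalPi B (Polynomial.C (powMatrix B).det) * t := by
  obtain ⟨a, rfl⟩ := (glue B).surjective t
  refine ⟨_, (glue_mulVec B ((powMatrix B).adjugate.mulVec a)).symm.trans ?_⟩
  rw [Matrix.mulVec_mulVec, Matrix.mul_adjugate, Matrix.smul_mulVec, Matrix.one_mulVec]
  ext1 i
  rw [Pi.mul_apply, glue_apply, glue_apply, evalPi_apply, eval_C, Finset.mul_sum]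
  refine Finset.sum_congr rfl fun l _ => ?_
  rw [Pi.smul_apply, smul_eq_mul, map_mul]
  ring

/-- The delta invariant of a ring isomorphic to the coordinate ring of the branches. -/
theorem length_delta {O : Type} [CommRing O] [Algebra ℂ O] [IsNoetherianRing O]
    (φ : O →ₐ[ℂ] (Fin r → ℂ⟦X⟧)) (hφ : Function.Injective φ)
    (hrange : LinearMap.range φ.toLinearMap = LinearMap.range (evalPi B).toLinearMap)
    (hB : Function.Injective fun i => (B i).poly) :
    Module.length ℂ (integralClosure O (FractionRing O) ⧸ LinearMap.range
      ((Algebra.linearMap O (integralClosure O (FractionRing O))).restrictScalars ℂ)) =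
      (powMatrix B).det.order := by
  have hmem : ∀ g, ∃ o, φ o = evalPi B g := fun g => by
    have : evalPi B g ∈ LinearMap.range φ.toLinearMap := hrange ▸ ⟨g, rfl⟩
    exact this
  obtain ⟨d, hd⟩ := hmem (Polynomial.C (powMatrix B).det)
  have hex : ∀ t, ∃ o, φ o = φ d * t := fun t => by
    obtain ⟨g, hg⟩ := exists_evalPi_eq_mul (B := B) t
    rw [hd, ← hg]
    exact hmem g
  choose s hs using hex
  have hd0 : ∀ i, φ d i ≠ 0 := fun i => by
    rw [hd, evalPi_apply, eval_C, Ne, map_eq_zero_iff _ (expandHom_injective _)]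
    exact det_powMatrix_ne_zero hB
  obtain ⟨e, he⟩ := exists_equiv_integralClosure hφ hd0 hs
  rw [← length_quotient_range_evalPi B (det_powMatrix_ne_zero hB)]
  refine (Submodule.Quotient.equiv _ _ e ?_).length_eq.symm
  rw [← hrange]
  ext u
  constructor
  · rintro ⟨_, ⟨o, rfl⟩, rfl⟩
    exact ⟨o, (he o).symm⟩
  · rintro ⟨o, rfl⟩
    exact ⟨φ o, ⟨o, rfl⟩, he o⟩

end PuiseuxBranch

lemma isDistinguishedAt_iff {Q : ℂ⟦X⟧[X]} (hQ : Q.Monic) :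
    Q.IsDistinguishedAt (IsLocalRing.maximalIdeal ℂ⟦X⟧) ↔
      Q.map (PowerSeries.constantCoeff (R := ℂ)) = Polynomial.X ^ Q.natDegree := by
  constructor
  · intro h
    ext i
    rw [Polynomial.coeff_map, Polynomial.coeff_X_pow]
    split_ifs with hi
    · rw [hi, hQ.coeff_natDegree, map_one]
    · rcases lt_or_gt_of_ne hi with hi | hi
      · exact mem_maximalIdeal_powerSeries_iff.1 (h.mem hi)
      · rw [Polynomial.coeff_eq_zero_of_natDegree_lt hi, map_zero]
  · intro h
    refine ⟨⟨fun {i} hi => mem_maximalIdeal_powerSeries_iff.2 ?_⟩, hQ⟩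
    rw [← Polynomial.coeff_map, h, Polynomial.coeff_X_pow, if_neg hi.ne]

lemma Polynomial.IsDistinguishedAt.map_coe_ne_zero {Q : ℂ⟦X⟧[X]}
    (hQ : Q.IsDistinguishedAt (IsLocalRing.maximalIdeal ℂ⟦X⟧)) :
    (Q : ℂ⟦X⟧⟦X⟧).map (PowerSeries.constantCoeff (R := ℂ)) ≠ 0 := by
  intro h
  have := congrArg (PowerSeries.coeff Q.natDegree) h
  rw [PowerSeries.coeff_map, Polynomial.coeff_coe, hQ.monic.coeff_natDegree] at this
  simp at this

lemma Polynomial.IsDistinguishedAt.exists_dvd_sub_coe {Q : ℂ⟦X⟧[X]}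
    (hQ : Q.IsDistinguishedAt (IsLocalRing.maximalIdeal ℂ⟦X⟧)) (G : ℂ⟦X⟧⟦X⟧) :
    ∃ g : ℂ⟦X⟧[X], (Q : ℂ⟦X⟧⟦X⟧) ∣ G - g := by
  obtain ⟨q, g, h⟩ := PowerSeries.exists_isWeierstrassDivision G
    (map_residue_ne_zero hQ.map_coe_ne_zero)
  exact ⟨g, q, by rw [h.eq_mul_add]; ring⟩

lemma Polynomial.IsDistinguishedAt.mem_of_coe_mem_map {Q : ℂ⟦X⟧[X]}
    (hQ : Q.IsDistinguishedAt (IsLocalRing.maximalIdeal ℂ⟦X⟧)) {I : Ideal ℂ⟦X⟧[X]} (hI : Q ∈ I)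
    {g : ℂ⟦X⟧[X]}
    (hg : (g : ℂ⟦X⟧⟦X⟧) ∈ I.map (Polynomial.coeToPowerSeries.ringHom (R := ℂ⟦X⟧))) : g ∈ I := by
  have key : ∀ s ∈ I.map (Polynomial.coeToPowerSeries.ringHom (R := ℂ⟦X⟧)),
      ∀ g : ℂ⟦X⟧[X], (Q : ℂ⟦X⟧⟦X⟧) ∣ s - g → g ∈ I := by
    intro s hs
    have hcong : ∀ a ∈ I, ∀ g : ℂ⟦X⟧[X], (Q : ℂ⟦X⟧⟦X⟧) ∣ a - g → g ∈ I := by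
      intro a ha g hg
      have : Q ∣ a - g := hQ.dvd_of_coe_dvd_coe (by rwa [Polynomial.coe_sub])
      have h := I.mem_of_dvd this hI
      simpa using I.sub_mem ha h
    induction hs using Submodule.span_induction with
    | mem s hs =>
      obtain ⟨a, ha, rfl⟩ := hs
      exact hcong a ha
    | zero => exact fun g hg => hcong 0 I.zero_mem g (by simpa using hg)
    | add s t _ _ hs ht =>
      intro g hg
      obtain ⟨a, ha⟩ := hQ.exists_dvd_sub_coe s
      obtain ⟨b, hb⟩ := hQ.exists_dvd_sub_coe t
      refine hcong (a + b) (I.add_mem (hs a ha) (ht b hb)) g ?_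
      rw [Polynomial.coe_add]
      convert dvd_sub hg (dvd_add ha hb) using 1
      ring
    | smul c s _ hs =>
      intro g hg
      obtain ⟨a, ha⟩ := hQ.exists_dvd_sub_coe s
      obtain ⟨b, hb⟩ := hQ.exists_dvd_sub_coe c
      refine hcong (b * a) (I.mul_mem_left _ (hs a ha)) g ?_
      rw [Polynomial.coe_mul]
      rw [smul_eq_mul] at hg
      convert dvd_sub hg (dvd_add (ha.mul_left c) (hb.mul_right (a : ℂ⟦X⟧⟦X⟧))) using 1
      ring
  exact key _ hg g (by simp)

/-- The inclusion of polynomials into power series, as a homomorphism of `ℂ`-algebras. -/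
def polyToPS : ℂ⟦X⟧[X] →ₐ[ℂ] ℂ⟦X⟧⟦X⟧ :=
  { Polynomial.coeToPowerSeries.ringHom (R := ℂ⟦X⟧) with
    commutes' := fun c => by
      change ((algebraMap ℂ ℂ⟦X⟧[X] c : ℂ⟦X⟧[X]) : ℂ⟦X⟧⟦X⟧) = _
      rw [Polynomial.algebraMap_apply, Polynomial.coe_C]
      exact (PowerSeries.algebraMap_apply (R := ℂ) (A := ℂ⟦X⟧)).symm }

/-- Modulo a distinguished polynomial, polynomials and power series agree. -/
def Polynomial.IsDistinguishedAt.quotientEquiv {Q : ℂ⟦X⟧[X]}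
    (hQ : Q.IsDistinguishedAt (IsLocalRing.maximalIdeal ℂ⟦X⟧)) {I : Ideal ℂ⟦X⟧[X]} (hI : Q ∈ I) :
    (ℂ⟦X⟧[X] ⧸ I) ≃ₐ[ℂ]
      (ℂ⟦X⟧⟦X⟧ ⧸ I.map (Polynomial.coeToPowerSeries.ringHom (R := ℂ⟦X⟧))) :=
  AlgEquiv.ofBijective (Ideal.quotientMapₐ _ polyToPS (fun _ hg => Ideal.mem_map_of_mem _ hg)) <| by
    constructor
    · exact Ideal.quotientMap_injective' (f := polyToPS.toRingHom)
        (H := fun _ hg => Ideal.mem_map_of_mem _ hg) fun g hg => hQ.mem_of_coe_mem_map hI hg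
    · intro y
      obtain ⟨G, rfl⟩ := Ideal.Quotient.mk_surjective y
      obtain ⟨g, hg⟩ := hQ.exists_dvd_sub_coe G
      refine ⟨Ideal.Quotient.mk _ g, ?_⟩
      change Ideal.Quotient.mk (I.map (Polynomial.coeToPowerSeries.ringHom (R := ℂ⟦X⟧)))
        (g : ℂ⟦X⟧⟦X⟧) = Ideal.Quotient.mk _ G
      rw [Ideal.Quotient.eq]
      rw [← neg_mem_iff, neg_sub]
      exact Ideal.mem_of_dvd _ hg (Ideal.mem_map_of_mem _ hI)

lemma Polynomial.IsDistinguishedAt.length_quotient_span_pair {Q : ℂ⟦X⟧[X]}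
    (hQ : Q.IsDistinguishedAt (IsLocalRing.maximalIdeal ℂ⟦X⟧)) (g : ℂ⟦X⟧[X]) :
    Module.length ℂ (ℂ⟦X⟧⟦X⟧ ⧸ Ideal.span {(Q : ℂ⟦X⟧⟦X⟧), (g : ℂ⟦X⟧⟦X⟧)}) =
      Module.length ℂ (ℂ⟦X⟧[X] ⧸ Ideal.span {Q, g}) := by
  rw [(hQ.quotientEquiv (I := Ideal.span {Q, g})
    (Ideal.subset_span (Set.mem_insert _ _))).toLinearEquiv.length_eq, Ideal.map_span,
    Set.image_pair]
  rfl

namespace PuiseuxBranch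

lemma map_constantCoeff_poly (B : PuiseuxBranch) (hB : PowerSeries.constantCoeff B.param = 0) :
    B.poly.map (PowerSeries.constantCoeff (R := ℂ)) = Polynomial.X ^ B.deg := by
  have h2 : (PowerSeries.constantCoeff (R := ℂ)).comp (expandHom B.deg B.deg_ne) =
      PowerSeries.constantCoeff := by
    ext1 a; simp [PowerSeries.constantCoeff_expand]
  rw [← h2, ← Polynomial.map_map, B.map_poly, Polynomial.map_prod]
  have h3 : ∀ k : Fin B.deg, (Polynomial.X - Polynomial.C (PowerSeries.rescale
      (stdRoot B.deg ^ (k : ℕ)) B.param)).map (PowerSeries.constantCoeff (R := ℂ)) =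
      Polynomial.X := by
    intro k
    rw [Polynomial.map_sub, Polynomial.map_X, Polynomial.map_C,
      ← PowerSeries.coeff_zero_eq_constantCoeff_apply, PowerSeries.coeff_rescale,
      PowerSeries.coeff_zero_eq_constantCoeff_apply, hB]
    simp
  rw [Finset.prod_congr rfl fun k _ => h3 k]
  simp

lemma isDistinguishedAt_poly (B : PuiseuxBranch) (hB : PowerSeries.constantCoeff B.param = 0) :
    B.poly.IsDistinguishedAt (IsLocalRing.maximalIdeal ℂ⟦X⟧) := by
  rw [isDistinguishedAt_iff B.monic, B.map_constantCoeff_poly hB, natDegree_poly]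

lemma constantCoeff_coeff_zero_poly (B : PuiseuxBranch)
    (hB : PowerSeries.constantCoeff B.param = 0) :
    PowerSeries.constantCoeff (B.poly.coeff 0) = 0 := by
  rw [← Polynomial.coeff_map, B.map_constantCoeff_poly hB, Polynomial.coeff_X_pow,
    if_neg B.deg_ne.symm]

lemma not_isUnit_coe_poly (B : PuiseuxBranch) (hB : PowerSeries.constantCoeff B.param = 0) :
    ¬ IsUnit (B.poly : ℂ⟦X⟧⟦X⟧) := by
  rw [PowerSeries.isUnit_iff_constantCoeff, ← PowerSeries.coeff_zero_eq_constantCoeff_apply,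
    Polynomial.coeff_coe, PowerSeries.isUnit_iff_constantCoeff,
    B.constantCoeff_coeff_zero_poly hB]
  simp

lemma isDistinguishedAt_prodPoly {r : ℕ} (B : Fin r → PuiseuxBranch)
    (hB : ∀ i, PowerSeries.constantCoeff (B i).param = 0) :
    (prodPoly B).IsDistinguishedAt (IsLocalRing.maximalIdeal ℂ⟦X⟧) := by
  rw [isDistinguishedAt_iff (monic_prodPoly B), natDegree_prodPoly, card_idx, prodPoly,
    Polynomial.map_prod, ← Finset.prod_pow_eq_pow_sum]
  exact Finset.prod_congr rfl fun i _ => (B i).map_constantCoeff_poly (hB i)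

lemma dvd_coe_iff (B : PuiseuxBranch) (hB : PowerSeries.constantCoeff B.param = 0)
    {g : ℂ⟦X⟧[X]} : (B.poly : ℂ⟦X⟧⟦X⟧) ∣ g ↔ B.poly ∣ g := by
  refine ⟨fun h => (B.isDistinguishedAt_poly hB).dvd_of_coe_dvd_coe h, ?_⟩
  rintro ⟨q, rfl⟩
  exact ⟨q, by rw [Polynomial.coe_mul]⟩

end PuiseuxBranch

lemma PowerSeries.derivative_mul {R : Type*} [CommRing R] (f g : R⟦X⟧) :
    PowerSeries.derivative R (f * g) =
      f * PowerSeries.derivative R g + PowerSeries.derivative R f * g := by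
  rw [Derivation.leibniz, smul_eq_mul, smul_eq_mul]
  ring

/-- The partial derivative in the inner variable on `ℂ⟦x⟧⟦y⟧`. -/
def xDeriv (F : ℂ⟦X⟧⟦X⟧) : ℂ⟦X⟧⟦X⟧ :=
  PowerSeries.mk fun i => PowerSeries.derivative ℂ (PowerSeries.coeff i F)

lemma coeff_xDeriv (F : ℂ⟦X⟧⟦X⟧) (i : ℕ) : PowerSeries.coeff i (xDeriv F) =
    PowerSeries.derivative ℂ (PowerSeries.coeff i F) := PowerSeries.coeff_mk _ _

lemma xDeriv_add (F G : ℂ⟦X⟧⟦X⟧) : xDeriv (F + G) = xDeriv F + xDeriv G := by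
  ext1 i
  simp only [coeff_xDeriv, map_add]

lemma xDeriv_mul (F G : ℂ⟦X⟧⟦X⟧) : xDeriv (F * G) = F * xDeriv G + xDeriv F * G := by
  ext1 i
  rw [coeff_xDeriv, map_add, PowerSeries.coeff_mul, PowerSeries.coeff_mul, PowerSeries.coeff_mul,
    map_sum, ← Finset.sum_add_distrib]
  refine Finset.sum_congr rfl fun p _ => ?_
  rw [Derivation.leibniz, coeff_xDeriv, coeff_xDeriv, smul_eq_mul, smul_eq_mul]
  ring

/-- The partial derivative in the inner variable on `ℂ⟦x⟧[y]`. -/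
def polyXDeriv (g : ℂ⟦X⟧[X]) : ℂ⟦X⟧[X] :=
  PowerSeries.trunc (g.natDegree + 1) (xDeriv g)

lemma coeff_polyXDeriv (g : ℂ⟦X⟧[X]) (i : ℕ) :
    (polyXDeriv g).coeff i = PowerSeries.derivative ℂ (g.coeff i) := by
  rw [polyXDeriv, PowerSeries.coeff_trunc, coeff_xDeriv, Polynomial.coeff_coe]
  split_ifs with h
  · rfl
  · rw [Polynomial.coeff_eq_zero_of_natDegree_lt (by omega), map_zero]

lemma coe_polyXDeriv (g : ℂ⟦X⟧[X]) : (polyXDeriv g : ℂ⟦X⟧⟦X⟧) = xDeriv g := by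
  ext1 i
  rw [Polynomial.coeff_coe, coeff_polyXDeriv, coeff_xDeriv, Polynomial.coeff_coe]

lemma derivative_expandHom {m : ℕ} (hm : m ≠ 0) (a : ℂ⟦X⟧) :
    PowerSeries.derivative ℂ (expandHom m hm a) =
      expandHom m hm (PowerSeries.derivative ℂ a) * ((m : ℂ⟦X⟧) * PowerSeries.X ^ (m - 1)) := by
  simp only [expandHom, RingHom.coe_coe, PowerSeries.expand_apply]
  rw [PowerSeries.derivative_subst (PowerSeries.HasSubst.X_pow hm), PowerSeries.derivative_pow,
    PowerSeries.derivative_X, mul_one]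

lemma order_eq_order_derivative_add_one {a : ℂ⟦X⟧} (ha : PowerSeries.constantCoeff a = 0) :
    a.order = (PowerSeries.derivative ℂ a).order + 1 := by
  rcases eq_or_ne a 0 with rfl | h0
  · simp
  have h1 := PowerSeries.order_eq_top.not.2 h0
  obtain ⟨k, hk⟩ := ENat.ne_top_iff_exists.1 h1
  obtain ⟨h2, h3⟩ := PowerSeries.order_eq_nat.1 hk.symm
  obtain ⟨k, rfl⟩ : ∃ j, k = j + 1 := by
    refine Nat.exists_eq_succ_of_ne_zero ?_
    rintro rfl
    exact h2 (by simpa using ha)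
  have h4 : (PowerSeries.derivative ℂ a).order = k := by
    rw [PowerSeries.order_eq_nat]
    constructor
    · rw [PowerSeries.coeff_derivative]
      exact mul_ne_zero h2 (by exact_mod_cast k.succ_ne_zero)
    · intro i hi
      rw [PowerSeries.coeff_derivative, h3 (i + 1) (by omega), zero_mul]
  rw [h4, ← hk]
  rfl

namespace PuiseuxBranch

lemma derivative_eval (B : PuiseuxBranch) (g : ℂ⟦X⟧[X]) :
    PowerSeries.derivative ℂ (B.eval g) =
      B.eval (polyXDeriv g) * ((B.deg : ℂ⟦X⟧) * PowerSeries.X ^ (B.deg - 1)) +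
        B.eval (Polynomial.derivative g) * PowerSeries.derivative ℂ B.param := by
  induction g using Polynomial.induction_on' with
  | add p q hp hq =>
    have : polyXDeriv (p + q) = polyXDeriv p + polyXDeriv q := by
      ext1 i
      simp only [coeff_polyXDeriv, Polynomial.coeff_add, map_add]
    rw [map_add, map_add, hp, hq, this, map_add, Polynomial.derivative_add, map_add]
    ring
  | monomial k a =>
    have : polyXDeriv (Polynomial.monomial k a) =
        Polynomial.monomial k (PowerSeries.derivative ℂ a) := by
      ext1 i
      rw [coeff_polyXDeriv, Polynomial.coeff_monomial, Polynomial.coeff_monomial]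
      split_ifs <;> simp
    rw [this, Polynomial.derivative_monomial]
    simp only [eval_apply, Polynomial.eval₂_monomial]
    rw [Derivation.leibniz, derivative_expandHom, PowerSeries.derivative_pow, smul_eq_mul,
      smul_eq_mul, map_mul, map_natCast]
    ring

lemma order_eval (B : PuiseuxBranch) (hB : PowerSeries.constantCoeff B.param = 0) {g : ℂ⟦X⟧[X]}
    (hg : B.poly ∣ Polynomial.derivative g) (h0 : PowerSeries.constantCoeff (g.coeff 0) = 0) :
    (B.eval g).order = (B.eval (polyXDeriv g)).order + B.deg := by
  have h1 : PowerSeries.constantCoeff (B.eval g) = 0 := by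
    rw [eval_apply, Polynomial.hom_eval₂, hB, Polynomial.eval₂_at_zero, RingHom.comp_apply]
    simpa [PowerSeries.constantCoeff_expand] using h0
  rw [order_eq_order_derivative_add_one h1, derivative_eval, B.eval_eq_zero_iff.2 hg, zero_mul,
    add_zero, PowerSeries.order_mul, PowerSeries.order_mul, PowerSeries.order_X_pow]
  have h2 : ((B.deg : ℂ⟦X⟧)).order = 0 := by
    have : (B.deg : ℂ⟦X⟧) = PowerSeries.C (B.deg : ℂ) := by simp
    rw [this]
    refine PowerSeries.order_zero_of_unit ?_
    rw [PowerSeries.isUnit_iff_constantCoeff]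
    simpa using B.deg_ne
  obtain ⟨k, hk⟩ := Nat.exists_eq_succ_of_ne_zero B.deg_ne
  rw [h2, hk, zero_add, add_assoc]
  rfl

end PuiseuxBranch

lemma Ideal.span_pair_eq_of_dvd_sub {R : Type*} [CommRing R] {a b c : R} (h : a ∣ b - c) :
    Ideal.span {a, b} = Ideal.span {a, c} := by
  obtain ⟨d, hd⟩ := h
  rw [show b = c + d * a by rw [mul_comm, ← hd]; ring]
  exact Ideal.span_pair_add_mul_left a c d

/-- Teissier's formula for the intersection number of a curve with its polar. -/
theorem length_quotient_polar {F : ℂ⟦X⟧⟦X⟧} {n : ℕ}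
    (hn : (F.map (PowerSeries.constantCoeff (R := ℂ))).order = (n + 1 : ℕ))
    (h : ∀ B : PuiseuxBranch, PowerSeries.constantCoeff B.param = 0 →
      (B.poly : ℂ⟦X⟧⟦X⟧) ∣ F → ¬ (B.poly : ℂ⟦X⟧⟦X⟧) ∣ PowerSeries.derivative ℂ⟦X⟧ F) :
    Module.length ℂ (ℂ⟦X⟧⟦X⟧ ⧸ Ideal.span {PowerSeries.derivative ℂ⟦X⟧ F, F}) =
      Module.length ℂ (ℂ⟦X⟧⟦X⟧ ⧸ Ideal.span {PowerSeries.derivative ℂ⟦X⟧ F, xDeriv F}) + n := by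
  set F' := PowerSeries.derivative ℂ⟦X⟧ F with hF'
  have hmap : F'.map (PowerSeries.constantCoeff (R := ℂ)) =
      PowerSeries.derivative ℂ (F.map (PowerSeries.constantCoeff (R := ℂ))) := by
    ext i
    simp [hF', PowerSeries.coeff_derivative]
  have hF0 : PowerSeries.constantCoeff (F.map (PowerSeries.constantCoeff (R := ℂ))) = 0 := by
    have := PowerSeries.coeff_of_lt_order (φ := F.map (PowerSeries.constantCoeff (R := ℂ))) 0
      (by rw [hn]; exact_mod_cast n.succ_pos)
    simpa only [PowerSeries.coeff_zero_eq_constantCoeff_apply] using this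
  have hF00 : PowerSeries.constantCoeff (PowerSeries.constantCoeff F) = 0 := by
    rwa [← PowerSeries.coeff_zero_eq_constantCoeff_apply, PowerSeries.coeff_map,
      PowerSeries.coeff_zero_eq_constantCoeff_apply (R := ℂ⟦X⟧)] at hF0
  have hord : (F'.map (PowerSeries.constantCoeff (R := ℂ))).order = n := by
    rw [hmap]
    rw [order_eq_order_derivative_add_one hF0] at hn
    push_cast at hn
    exact ENat.add_left_injective_of_ne_top ENat.one_ne_top hn
  obtain ⟨Q, v, hQ⟩ := PowerSeries.exists_isWeierstrassFactorization
    (map_residue_ne_zero (F := F') (by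
      intro h0; rw [h0, PowerSeries.order_zero] at hord; exact ENat.top_ne_natCast n hord))
  have hQd := hQ.isDistinguishedAt
  have hv := hQ.isUnit
  have hFQ := hQ.eq_mul
  have hQdeg : Q.natDegree = n := by
    have h1 : (Q : ℂ⟦X⟧⟦X⟧).map (PowerSeries.constantCoeff (R := ℂ)) =
        PowerSeries.X ^ Q.natDegree := by
      rw [← Polynomial.polynomial_map_coe, (isDistinguishedAt_iff hQd.monic).1 hQd]
      simp
    rw [hFQ, map_mul, PowerSeries.order_mul, h1, PowerSeries.order_X_pow,
      PowerSeries.order_zero_of_unit (hv.map _), add_zero] at hord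
    exact_mod_cast hord
  obtain ⟨l, hl⟩ := PuiseuxBranch.exists_list_prod hQd.monic
  have hlQ : ∀ B ∈ l, B.poly ∣ Q := fun B hB => by
    rw [hl]; exact List.dvd_prod (List.mem_map_of_mem hB)
  have hlc : ∀ B ∈ l, PowerSeries.constantCoeff B.param = 0 := fun B hB =>
    B.constantCoeff_param hQd (hlQ B hB)
  have hQF' : (Q : ℂ⟦X⟧⟦X⟧) ∣ F' := ⟨v, hFQ⟩
  obtain ⟨ρ, q, hq⟩ := (hQd.mul hQd).exists_dvd_sub_coe F
  rw [Polynomial.coe_mul] at hq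
  have hFρ : F = (Q : ℂ⟦X⟧⟦X⟧) * Q * q + ρ := by rw [← hq]; ring
  have hρF : (Q : ℂ⟦X⟧⟦X⟧) ∣ F - ρ := ⟨Q * q, by rw [hq]; ring⟩
  have hρx : (Q : ℂ⟦X⟧⟦X⟧) ∣ xDeriv F - (polyXDeriv ρ : ℂ⟦X⟧[X]) := by
    rw [coe_polyXDeriv]
    conv_rhs => rw [hFρ, xDeriv_add, xDeriv_mul, xDeriv_mul]
    exact ⟨Q * xDeriv q + (xDeriv Q + xDeriv Q) * q, by ring⟩
  have hρy : Q ∣ Polynomial.derivative ρ := by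
    apply hQd.dvd_of_coe_dvd_coe
    rw [← PowerSeries.derivative_coe]
    have h1 : (ρ : ℂ⟦X⟧⟦X⟧) = F - (Q : ℂ⟦X⟧⟦X⟧) * Q * q := by rw [hFρ]; ring
    rw [h1, map_sub, PowerSeries.derivative_mul, PowerSeries.derivative_mul]
    refine dvd_sub hQF' ⟨Q * PowerSeries.derivative ℂ⟦X⟧ q +
      q * (PowerSeries.derivative ℂ⟦X⟧ Q + PowerSeries.derivative ℂ⟦X⟧ Q), by ring⟩
  have hρ0 : ∀ B ∈ l, PowerSeries.constantCoeff (ρ.coeff 0) = 0 := by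
    intro B hB
    have hQ0 : PowerSeries.constantCoeff (Q.coeff 0) = 0 := by
      obtain ⟨s, hs⟩ := hlQ B hB
      rw [hs, Polynomial.mul_coeff_zero, map_mul, B.constantCoeff_coeff_zero_poly (hlc B hB),
        zero_mul]
    have h1 : ρ.coeff 0 = PowerSeries.constantCoeff F - Q.coeff 0 * Q.coeff 0 *
        PowerSeries.constantCoeff q := by
      rw [hFρ, map_add, map_mul, map_mul]
      simp only [← PowerSeries.coeff_zero_eq_constantCoeff_apply, Polynomial.coeff_coe]
      ring
    rw [h1, map_sub, map_mul, map_mul, hQ0]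
    simpa using hF00
  have hne : ∀ B ∈ l, B.eval ρ ≠ 0 := by
    intro B hB h0
    have hBQ : (B.poly : ℂ⟦X⟧⟦X⟧) ∣ Q := (B.dvd_coe_iff (hlc B hB)).2 (hlQ B hB)
    refine h B (hlc B hB) ?_ (hBQ.trans hQF')
    rw [← dvd_sub_right ((B.dvd_coe_iff (hlc B hB)).2 (B.eval_eq_zero_iff.1 h0))]
    exact hBQ.trans ((dvd_sub_comm).1 hρF)
  have hord2 : ∀ B ∈ l, (B.eval ρ).order = (B.eval (polyXDeriv ρ)).order + B.deg := fun B hB =>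
    B.order_eval (hlc B hB) ((hlQ B hB).trans hρy) (hρ0 B hB)
  have hne2 : ∀ B ∈ l, B.eval (polyXDeriv ρ) ≠ 0 := by
    intro B hB h0
    apply hne B hB
    rw [← PowerSeries.order_eq_top, hord2 B hB, h0]
    simp
  have hspan : ∀ G : ℂ⟦X⟧⟦X⟧, Ideal.span {F', G} = Ideal.span {(Q : ℂ⟦X⟧⟦X⟧), G} := by
    intro G
    rw [Ideal.span_insert, Ideal.span_insert, hFQ, Ideal.span_singleton_mul_right_unit hv]
  rw [hspan, hspan, Ideal.span_pair_eq_of_dvd_sub hρF, Ideal.span_pair_eq_of_dvd_sub hρx,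
    hQd.length_quotient_span_pair, hQd.length_quotient_span_pair, hl,
    PuiseuxBranch.length_quotient_list l _ hne, PuiseuxBranch.length_quotient_list l _ hne2,
    List.map_congr_left hord2, List.sum_map_add]
  congr 1
  have h5 : ∀ l : List PuiseuxBranch, (l.map fun B => (B.deg : ℕ∞)).sum =
      (((l.map PuiseuxBranch.poly).prod.natDegree : ℕ) : ℕ∞) := by
    intro l
    induction l with
    | nil => simp
    | cons B l ih =>
      rw [List.map_cons, List.sum_cons, ih, List.map_cons, List.prod_cons,
        B.monic.natDegree_mul (PuiseuxBranch.monic_list_prod l), B.natDegree_poly]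
      push_cast
      rfl
  rw [h5, ← hl, hQdeg]

namespace PuiseuxBranch

lemma exists_associated {G : ℂ⟦X⟧⟦X⟧} (hG : Irreducible G)
    (h0 : G.map (PowerSeries.constantCoeff (R := ℂ)) ≠ 0) :
    ∃ B : PuiseuxBranch, PowerSeries.constantCoeff B.param = 0 ∧
      Associated (B.poly : ℂ⟦X⟧⟦X⟧) G := by
  obtain ⟨Q, v, hQ⟩ := PowerSeries.exists_isWeierstrassFactorization (map_residue_ne_zero h0)
  have hQd := hQ.isDistinguishedAt
  have hpos : 0 < Q.natDegree := by
    rw [Nat.pos_iff_ne_zero]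
    intro h
    have h1 : Q = 1 := hQd.monic.natDegree_eq_zero.1 h
    apply hG.not_isUnit
    rw [hQ.eq_mul, h1, Polynomial.coe_one, one_mul]
    exact hQ.isUnit
  obtain ⟨B, hB⟩ := exists_dvd hQd.monic hpos
  have hc := B.constantCoeff_param hQd hB
  refine ⟨B, hc, ?_⟩
  have h2 : (B.poly : ℂ⟦X⟧⟦X⟧) ∣ G :=
    ((B.dvd_coe_iff hc).2 hB).trans ⟨v, hQ.eq_mul⟩
  obtain ⟨s, hs⟩ := h2
  rcases hG.isUnit_or_isUnit hs with h | h
  · exact absurd h (B.not_isUnit_coe_poly hc)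
  · exact ⟨h.unit, hs.symm⟩

lemma exists_associated_prodPoly {F : ℂ⟦X⟧⟦X⟧}
    (h0 : F.map (PowerSeries.constantCoeff (R := ℂ)) ≠ 0) {r : ℕ} {g : Fin r → ℂ⟦X⟧⟦X⟧}
    (hirr : ∀ i, Irreducible (g i)) (hdist : ∀ i j, i ≠ j → ¬ Associated (g i) (g j))
    (hF : Associated (∏ i, g i) F) :
    ∃ B : Fin r → PuiseuxBranch, (∀ i, PowerSeries.constantCoeff (B i).param = 0) ∧
      Function.Injective (fun i => (B i).poly) ∧ Associated (prodPoly B : ℂ⟦X⟧⟦X⟧) F := by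
  have h1 : ∀ i, (g i).map (PowerSeries.constantCoeff (R := ℂ)) ≠ 0 := by
    intro i hi
    apply h0
    obtain ⟨s, hs⟩ := (Finset.dvd_prod_of_mem g (Finset.mem_univ i)).trans hF.dvd
    rw [hs, map_mul, hi, zero_mul]
  choose B hc hB using fun i => exists_associated (hirr i) (h1 i)
  refine ⟨B, hc, ?_, ?_⟩
  · intro i j hij
    by_contra hne
    refine hdist i j hne ((hB i).symm.trans ?_)
    have : (B i).poly = (B j).poly := hij
    rw [this]
    exact hB j
  · have h2 : (prodPoly B : ℂ⟦X⟧⟦X⟧) = ∏ i, ((B i).poly : ℂ⟦X⟧⟦X⟧) := by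
      rw [prodPoly]
      exact map_prod (Polynomial.coeToPowerSeries.ringHom (R := ℂ⟦X⟧))
        (fun i => (B i).poly) Finset.univ
    rw [h2]
    exact (Associated.prod Finset.univ _ _ fun i _ => hB i).trans hF

end PuiseuxBranch

lemma span_derivative_eq {F P : ℂ⟦X⟧⟦X⟧} (h : Associated P F) :
    Ideal.span {PowerSeries.derivative ℂ⟦X⟧ F, F} =
      Ideal.span {P, PowerSeries.derivative ℂ⟦X⟧ P} := by
  obtain ⟨u, rfl⟩ := h
  rw [Ideal.span_pair_comm, Ideal.span_insert, Ideal.span_singleton_mul_right_unit u.isUnit,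
    ← Ideal.span_insert, Ideal.span_pair_eq_of_dvd_sub (c := PowerSeries.derivative ℂ⟦X⟧ P * u),
    Ideal.span_insert, Ideal.span_singleton_mul_right_unit u.isUnit, ← Ideal.span_insert]
  · rw [PowerSeries.derivative_mul]
    exact ⟨PowerSeries.derivative ℂ⟦X⟧ u, add_sub_cancel_right _ _⟩

namespace PuiseuxBranch

variable {r : ℕ} {B : Fin r → PuiseuxBranch}

lemma not_dvd_derivative
    (hB : Function.Injective fun i => (B i).poly) {F : ℂ⟦X⟧⟦X⟧}
    (hF : Associated (prodPoly B : ℂ⟦X⟧⟦X⟧) F) (D : PuiseuxBranch)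
    (hD : PowerSeries.constantCoeff D.param = 0) (h : (D.poly : ℂ⟦X⟧⟦X⟧) ∣ F) :
    ¬ (D.poly : ℂ⟦X⟧⟦X⟧) ∣ PowerSeries.derivative ℂ⟦X⟧ F := by
  intro h'
  have h1 : Ideal.span {PowerSeries.derivative ℂ⟦X⟧ F, F} ≤
      Ideal.span {(D.poly : ℂ⟦X⟧⟦X⟧)} := by
    rw [Ideal.span_le]
    rintro x (rfl | rfl)
    · exact Ideal.mem_span_singleton.2 h'
    · exact Ideal.mem_span_singleton.2 h
  rw [span_derivative_eq hF, Ideal.span_le] at h1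
  have h2 := Ideal.mem_span_singleton.1 (h1 (Set.mem_insert _ _))
  have h3 := Ideal.mem_span_singleton.1 (h1 (Set.mem_insert_of_mem _ rfl))
  rw [PowerSeries.derivative_coe] at h3
  rw [D.dvd_coe_iff hD] at h2 h3
  obtain ⟨i, -, hi⟩ := D.poly_prime.exists_mem_finset_dvd h2
  have h4 : D.poly = (B i).poly :=
    Polynomial.eq_of_monic_of_associated D.monic (B i).monic
      (D.poly_prime.irreducible.associated_of_dvd (B i).poly_prime.irreducible hi)
  exact eval_derivative_ne_zero hB i ((B i).eval_eq_zero_iff.2 (h4 ▸ h3))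

/-- The length of the intersection of a curve with its generic polar, by branches. -/
lemma length_quotient_derivative (hc : ∀ i, PowerSeries.constantCoeff (B i).param = 0)
    (hB : Function.Injective fun i => (B i).poly) {F : ℂ⟦X⟧⟦X⟧}
    (hF : Associated (prodPoly B : ℂ⟦X⟧⟦X⟧) F) :
    Module.length ℂ (ℂ⟦X⟧⟦X⟧ ⧸ Ideal.span {PowerSeries.derivative ℂ⟦X⟧ F, F}) =
      ∑ i, ((B i).eval (Polynomial.derivative (prodPoly B))).order := by
  have h1 : prodPoly B = ((List.ofFn B).map poly).prod := by
    rw [List.map_ofFn, List.prod_ofFn]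
    rfl
  rw [span_derivative_eq hF, PowerSeries.derivative_coe,
    (isDistinguishedAt_prodPoly B hc).length_quotient_span_pair]
  have h2 := length_quotient_list (List.ofFn B) (Polynomial.derivative (prodPoly B)) (by
    intro D hD
    obtain ⟨i, rfl⟩ := (List.mem_ofFn' _ _).1 hD
    exact eval_derivative_ne_zero hB i)
  rw [← h1] at h2
  rw [h2, List.map_ofFn, List.sum_ofFn]
  rfl

/-- Milnor's formula for a product of branches, before cancellation. -/
theorem milnor_formula (hr : r ≠ 0) (hc : ∀ i, PowerSeries.constantCoeff (B i).param = 0)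
    (hB : Function.Injective fun i => (B i).poly) {F : ℂ⟦X⟧⟦X⟧}
    (hF : Associated (prodPoly B : ℂ⟦X⟧⟦X⟧) F) :
    Module.length ℂ (ℂ⟦X⟧⟦X⟧ ⧸ Ideal.span {PowerSeries.derivative ℂ⟦X⟧ F, xDeriv F}) + r =
      2 • (powMatrix B).det.order + 1 := by
  have hn : Fintype.card (Idx B) ≠ 0 := by
    rw [card_idx]
    have : Nonempty (Fin r) := ⟨⟨0, Nat.pos_of_ne_zero hr⟩⟩
    exact (Finset.sum_pos (fun i _ => Nat.pos_of_ne_zero (B i).deg_ne)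
      Finset.univ_nonempty).ne'
  obtain ⟨n, hn⟩ := Nat.exists_eq_succ_of_ne_zero hn
  have hord : (F.map (PowerSeries.constantCoeff (R := ℂ))).order = (n + 1 : ℕ) := by
    obtain ⟨u, rfl⟩ := hF
    have h1 : (prodPoly B : ℂ⟦X⟧⟦X⟧).map (PowerSeries.constantCoeff (R := ℂ)) =
        PowerSeries.X ^ (n + 1) := by
      rw [← Polynomial.polynomial_map_coe, (isDistinguishedAt_iff (monic_prodPoly B)).1
        (isDistinguishedAt_prodPoly B hc), natDegree_prodPoly, hn]
      simp
    rw [map_mul, PowerSeries.order_mul, h1, PowerSeries.order_X_pow,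
      PowerSeries.order_zero_of_unit (u.isUnit.map _), add_zero]
  have h1 := length_quotient_polar hord (not_dvd_derivative hB hF)
  have h2 := sum_order_derivative_add (B := B)
  rw [← length_quotient_derivative hc hB hF, h1, hn] at h2
  push_cast at h2
  refine ENat.add_left_injective_of_ne_top (n := (n : ℕ∞)) (ENat.natCast_ne_top n) ?_
  change _ + _ = _ + _
  rw [add_right_comm, h2]
  ring

/-- The coordinate ring of a curve embeds into the product of the parameter rings of its
branches. -/
theorem exists_parametrization (hc : ∀ i, PowerSeries.constantCoeff (B i).param = 0)
    (hB : Function.Injective fun i => (B i).poly) {F : ℂ⟦X⟧⟦X⟧}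
    (hF : Associated (prodPoly B : ℂ⟦X⟧⟦X⟧) F) :
    ∃ φ : (ℂ⟦X⟧⟦X⟧ ⧸ Ideal.span {F}) →ₐ[ℂ] (Fin r → ℂ⟦X⟧), Function.Injective φ ∧
      LinearMap.range φ.toLinearMap = LinearMap.range (evalPi B).toLinearMap := by
  have hspan : Ideal.span {F} = (Ideal.span {prodPoly B}).map
      (Polynomial.coeToPowerSeries.ringHom (R := ℂ⟦X⟧)) := by
    rw [Ideal.map_span, Set.image_singleton]
    exact (Ideal.span_singleton_eq_span_singleton.2 hF).symm
  rw [hspan]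
  let e := (isDistinguishedAt_prodPoly B hc).quotientEquiv (I := Ideal.span {prodPoly B})
    (Ideal.mem_span_singleton_self _)
  let ψ : (ℂ⟦X⟧[X] ⧸ Ideal.span {prodPoly B}) →ₐ[ℂ] (Fin r → ℂ⟦X⟧) :=
    Ideal.Quotient.liftₐ _ (evalPi B) fun a ha =>
      (evalPi_eq_zero_iff hB).2 (Ideal.mem_span_singleton.1 ha)
  have hψ : Function.Injective ψ := by
    rw [injective_iff_map_eq_zero]
    intro a ha
    obtain ⟨a, rfl⟩ := Ideal.Quotient.mk_surjective a
    exact Ideal.Quotient.eq_zero_iff_mem.2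
      (Ideal.mem_span_singleton.2 ((evalPi_eq_zero_iff hB).1 ha))
  refine ⟨ψ.comp e.symm.toAlgHom, hψ.comp e.symm.injective, ?_⟩
  ext y
  constructor
  · rintro ⟨a, rfl⟩
    obtain ⟨b, hb⟩ := Ideal.Quotient.mk_surjective (e.symm a)
    refine ⟨b, ?_⟩
    change evalPi B b = ψ (e.symm a)
    rw [← hb]
    rfl
  · rintro ⟨b, rfl⟩
    refine ⟨e (Ideal.Quotient.mk _ b), ?_⟩
    change ψ (e.symm (e _)) = _
    rw [e.symm_apply_apply]
    rfl

end PuiseuxBranch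

lemma toPS_C (a : ℂ) : toPS (MvPolynomial.C a) = algebraMap ℂ PlanePS a :=
  MvPolynomial.coe_C a

lemma toPS_X (i : Fin 2) : toPS (MvPolynomial.X i) = MvPowerSeries.X i :=
  MvPolynomial.coe_X i

lemma constantCoeff_toPS (f : MvPolynomial (Fin 2) ℂ) :
    MvPowerSeries.constantCoeff (toPS f) = MvPolynomial.eval (fun _ => (0 : ℂ)) f := by
  change MvPowerSeries.coeff 0 (f : PlanePS) = _
  rw [MvPolynomial.coeff_coe, ← MvPolynomial.constantCoeff_eq]
  rw [MvPolynomial.eval_zero']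

/-- The two variables `x, y` as `some (), none`. -/
def finTwoEquivOptionUnit : Fin 2 ≃ Option Unit where
  toFun := ![some (), none]
  invFun o := o.elim 1 fun _ => 0
  left_inv i := by fin_cases i <;> rfl
  right_inv o := by rcases o with _ | _ <;> rfl

/-- The identification `ℂ⟦x,y⟧ = ℂ⟦x⟧⟦y⟧`. -/
def iteratedEquiv : PlanePS ≃ₐ[ℂ] ℂ⟦X⟧⟦X⟧ :=
  (MvPowerSeries.renameEquiv ℂ finTwoEquivOptionUnit).trans (MvPowerSeries.optionEquivLeft Unit ℂ)

lemma iteratedEquiv_X_zero :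
    iteratedEquiv (MvPowerSeries.X 0) = PowerSeries.C (PowerSeries.X : ℂ⟦X⟧) := by
  change MvPowerSeries.optionEquivLeft Unit ℂ
    (MvPowerSeries.rename finTwoEquivOptionUnit (MvPowerSeries.X 0)) = _
  rw [MvPowerSeries.rename_X]
  exact MvPowerSeries.optionEquivLeft_X_some ()

lemma iteratedEquiv_X_one : iteratedEquiv (MvPowerSeries.X 1) = PowerSeries.X := by
  change MvPowerSeries.optionEquivLeft Unit ℂ
    (MvPowerSeries.rename finTwoEquivOptionUnit (MvPowerSeries.X 1)) = _
  rw [MvPowerSeries.rename_X]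
  exact MvPowerSeries.optionEquivLeft_X_none

/-- The images of the variables under the shear `x ↦ x + l y`. -/
def shearVars (l : ℂ) : Fin 2 → PlanePS :=
  ![MvPowerSeries.X 0 + l • MvPowerSeries.X 1, MvPowerSeries.X 1]

lemma hasSubst_shearVars (l : ℂ) : MvPowerSeries.HasSubst (shearVars l) := by
  refine MvPowerSeries.hasSubst_of_constantCoeff_zero fun i => ?_
  fin_cases i <;> simp [shearVars]

lemma substAlgHom_shearVars_comp (l m : ℂ) (h : l + m = 0) :
    (MvPowerSeries.substAlgHom (R := ℂ) (hasSubst_shearVars l)).comp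
      (MvPowerSeries.substAlgHom (R := ℂ) (hasSubst_shearVars m)) = AlgHom.id ℂ PlanePS := by
  have h1 : (fun i => MvPowerSeries.subst (shearVars l) (shearVars m i)) =
      (MvPowerSeries.X : Fin 2 → PlanePS) := by
    funext i
    rw [← MvPowerSeries.substAlgHom_apply (hasSubst_shearVars l)]
    fin_cases i
    · change MvPowerSeries.substAlgHom (R := ℂ) (hasSubst_shearVars l)
        (MvPowerSeries.X 0 + m • MvPowerSeries.X 1) = _
      rw [map_add, map_smul, MvPowerSeries.substAlgHom_X, MvPowerSeries.substAlgHom_X]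
      change MvPowerSeries.X 0 + l • MvPowerSeries.X 1 + m • MvPowerSeries.X 1 = _
      rw [add_assoc, ← add_smul, h, zero_smul, add_zero]
      rfl
    · exact MvPowerSeries.substAlgHom_X _ 1
  ext1 F
  change MvPowerSeries.substAlgHom (R := ℂ) (hasSubst_shearVars l)
    (MvPowerSeries.substAlgHom (R := ℂ) (hasSubst_shearVars m) F) = F
  rw [MvPowerSeries.substAlgHom_apply, MvPowerSeries.substAlgHom_apply,
    MvPowerSeries.subst_comp_subst_apply (hasSubst_shearVars m) (hasSubst_shearVars l), h1,
    MvPowerSeries.subst_self]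
  rfl

/-- The change of coordinates `x ↦ x + l y`. -/
def shearEquiv (l : ℂ) : PlanePS ≃ₐ[ℂ] PlanePS :=
  AlgEquiv.ofAlgHom (MvPowerSeries.substAlgHom (hasSubst_shearVars l))
    (MvPowerSeries.substAlgHom (hasSubst_shearVars (-l)))
    (substAlgHom_shearVars_comp _ _ (add_neg_cancel l))
    (substAlgHom_shearVars_comp _ _ (neg_add_cancel l))

/-- The identification of `ℂ⟦x,y⟧` with `ℂ⟦x⟧⟦y⟧` after the shear `x ↦ x + l y`. -/
def shearIteratedEquiv (l : ℂ) : PlanePS ≃ₐ[ℂ] ℂ⟦X⟧⟦X⟧ :=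
  (shearEquiv l).trans iteratedEquiv

lemma shearIteratedEquiv_C (l a : ℂ) :
    shearIteratedEquiv l (toPS (MvPolynomial.C a)) = PowerSeries.C (PowerSeries.C a) := by
  rw [toPS_C, AlgEquiv.commutes]
  exact PowerSeries.algebraMap_apply (R := ℂ) (A := ℂ⟦X⟧)

lemma shearIteratedEquiv_X_zero (l : ℂ) :
    shearIteratedEquiv l (toPS (MvPolynomial.X 0)) =
      PowerSeries.C PowerSeries.X + PowerSeries.C (PowerSeries.C l) * PowerSeries.X := by
  rw [toPS_X]
  change iteratedEquiv (MvPowerSeries.substAlgHom (hasSubst_shearVars l) (MvPowerSeries.X 0)) = _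
  rw [MvPowerSeries.substAlgHom_X]
  change iteratedEquiv (MvPowerSeries.X 0 + l • MvPowerSeries.X 1) = _
  rw [map_add, iteratedEquiv_X_zero, Algebra.smul_def, map_mul, AlgEquiv.commutes,
    iteratedEquiv_X_one]
  congr 2
  exact PowerSeries.algebraMap_apply (R := ℂ) (A := ℂ⟦X⟧)

lemma shearIteratedEquiv_X_one (l : ℂ) :
    shearIteratedEquiv l (toPS (MvPolynomial.X 1)) = PowerSeries.X := by
  rw [toPS_X]
  change iteratedEquiv (MvPowerSeries.substAlgHom (hasSubst_shearVars l) (MvPowerSeries.X 1)) = _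
  rw [MvPowerSeries.substAlgHom_X]
  exact iteratedEquiv_X_one

lemma xDeriv_C (a : ℂ⟦X⟧) :
    xDeriv (PowerSeries.C a) = PowerSeries.C (PowerSeries.derivative ℂ a) := by
  ext1 i
  rw [coeff_xDeriv, PowerSeries.coeff_C, PowerSeries.coeff_C]
  split_ifs <;> simp

lemma xDeriv_X : xDeriv (PowerSeries.X : ℂ⟦X⟧⟦X⟧) = 0 := by
  ext1 i
  rw [coeff_xDeriv, PowerSeries.coeff_X]
  split_ifs <;> simp

lemma xDeriv_shearIteratedEquiv (l : ℂ) (f : MvPolynomial (Fin 2) ℂ) :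
    xDeriv (shearIteratedEquiv l (toPS f)) =
      shearIteratedEquiv l (toPS (MvPolynomial.pderiv 0 f)) := by
  induction f using MvPolynomial.induction_on with
  | C a =>
    rw [MvPolynomial.pderiv_C, map_zero, map_zero, shearIteratedEquiv_C, xDeriv_C]
    simp
  | add p q hp hq => simp only [map_add, xDeriv_add, hp, hq]
  | mul_X p i hp =>
    rw [map_mul, map_mul, xDeriv_mul, hp, Derivation.leibniz]
    simp only [smul_eq_mul, map_add, map_mul]
    fin_cases i
    · simp [shearIteratedEquiv_X_zero, xDeriv_add, xDeriv_mul, xDeriv_C, xDeriv_X,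
        MvPolynomial.pderiv_X]
      ring
    · simp [shearIteratedEquiv_X_one, xDeriv_X, MvPolynomial.pderiv_X]
      ring

lemma derivative_shearIteratedEquiv (l : ℂ) (f : MvPolynomial (Fin 2) ℂ) :
    PowerSeries.derivative ℂ⟦X⟧ (shearIteratedEquiv l (toPS f)) =
      PowerSeries.C (PowerSeries.C l) * shearIteratedEquiv l (toPS (MvPolynomial.pderiv 0 f)) +
      shearIteratedEquiv l (toPS (MvPolynomial.pderiv 1 f)) := by
  induction f using MvPolynomial.induction_on with
  | C a =>
    rw [MvPolynomial.pderiv_C, MvPolynomial.pderiv_C, map_zero, map_zero, shearIteratedEquiv_C,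
      PowerSeries.derivative_C]
    simp
  | add p q hp hq =>
    simp only [map_add, hp, hq]
    ring
  | mul_X p i hp =>
    rw [map_mul, map_mul, PowerSeries.derivative_mul, hp, Derivation.leibniz, Derivation.leibniz]
    simp only [smul_eq_mul, map_add, map_mul]
    fin_cases i
    · simp [shearIteratedEquiv_X_zero, PowerSeries.derivative_C,
        PowerSeries.derivative_X, MvPolynomial.pderiv_X]
      ring
    · simp [shearIteratedEquiv_X_one, PowerSeries.derivative_X, MvPolynomial.pderiv_X]
      ring

lemma exists_map_shearIteratedEquiv_ne_zero {f : MvPolynomial (Fin 2) ℂ} (hf : f ≠ 0) :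
    ∃ l : ℂ, (shearIteratedEquiv l (toPS f)).map (PowerSeries.constantCoeff (R := ℂ)) ≠ 0 := by
  obtain ⟨v, hv⟩ : ∃ v : Fin 2 → ℂ, MvPolynomial.eval v (f * MvPolynomial.X 1) ≠ 0 := by
    by_contra! h
    exact mul_ne_zero hf (MvPolynomial.X_ne_zero 1) (MvPolynomial.funext fun v => by simp [h v])
  rw [map_mul, MvPolynomial.eval_X] at hv
  refine ⟨v 0 / v 1, ?_⟩
  set l := v 0 / v 1
  let ψ : MvPolynomial (Fin 2) ℂ →ₐ[ℂ] ℂ[X] :=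
    MvPolynomial.aeval ![Polynomial.C l * Polynomial.X, Polynomial.X]
  have h1 : ∀ p, (shearIteratedEquiv l (toPS p)).map (PowerSeries.constantCoeff (R := ℂ)) =
      (ψ p : ℂ[X]) := by
    intro p
    induction p using MvPolynomial.induction_on with
    | C a =>
      rw [shearIteratedEquiv_C]
      simp [ψ]
    | add p q hp hq => simp only [map_add, hp, hq, Polynomial.coe_add]
    | mul_X p i hp =>
      rw [map_mul, map_mul, map_mul, hp, map_mul, Polynomial.coe_mul]
      congr 1
      fin_cases i
      · simp [shearIteratedEquiv_X_zero, ψ]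
      · simp [shearIteratedEquiv_X_one, ψ]
  have h2 : ∀ p, (ψ p).eval (v 1) = MvPolynomial.eval v p := by
    intro p
    induction p using MvPolynomial.induction_on with
    | C a => simp [ψ]
    | add p q hp hq => simp only [map_add, hp, hq, Polynomial.eval_add]
    | mul_X p i hp =>
      rw [map_mul, map_mul, Polynomial.eval_mul, hp]
      congr 1
      fin_cases i
      · simp [ψ, l, right_ne_zero_of_mul hv]
      · simp [ψ]
  rw [h1]
  intro h3
  rw [Polynomial.coe_eq_zero_iff] at h3
  have := h2 f
  rw [h3, Polynomial.eval_zero] at this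
  exact left_ne_zero_of_mul hv this.symm

lemma length_milnorAlgebra (l : ℂ) (f : MvPolynomial (Fin 2) ℂ) :
    Module.length ℂ (MilnorAlgebra f) = Module.length ℂ (ℂ⟦X⟧⟦X⟧ ⧸ Ideal.span
      {PowerSeries.derivative ℂ⟦X⟧ (shearIteratedEquiv l (toPS f)),
        xDeriv (shearIteratedEquiv l (toPS f))}) := by
  refine (Ideal.quotientEquivAlg _ _ (shearIteratedEquiv l) ?_).toLinearEquiv.length_eq
  rw [xDeriv_shearIteratedEquiv, derivative_shearIteratedEquiv, Ideal.map_span, Set.image_pair,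
    Ideal.span_pair_comm (x := _ + _), add_comm, Ideal.span_pair_add_mul_left]
  rfl

lemma exists_puiseuxBranches {f : MvPolynomial (Fin 2) ℂ} (hf : f ≠ 0) {r : ℕ}
    {g : Fin r → PlanePS} (hirr : ∀ i, Irreducible (g i))
    (hdist : ∀ i j, i ≠ j → ¬ Associated (g i) (g j)) {c : PlanePSˣ}
    (hfac : toPS f = (c : PlanePS) * ∏ i, g i) :
    ∃ (l : ℂ) (B : Fin r → PuiseuxBranch), (∀ i, PowerSeries.constantCoeff (B i).param = 0) ∧
      Function.Injective (fun i => (B i).poly) ∧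
      Associated (PuiseuxBranch.prodPoly B : ℂ⟦X⟧⟦X⟧) (shearIteratedEquiv l (toPS f)) := by
  obtain ⟨l, hl⟩ := exists_map_shearIteratedEquiv_ne_zero hf
  refine ⟨l, PuiseuxBranch.exists_associated_prodPoly hl
    (g := fun i => shearIteratedEquiv l (g i))
    (fun i => (MulEquiv.irreducible_iff (shearIteratedEquiv l)).2 (hirr i)) ?_ ?_⟩
  · intro i j hij h
    have h1 := h.map (shearIteratedEquiv l).symm
    rw [AlgEquiv.symm_apply_apply, AlgEquiv.symm_apply_apply] at h1
    exact hdist i j hij h1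
  · have h1 : Associated (∏ i, g i) (toPS f) := ⟨c, by rw [hfac, mul_comm]⟩
    have h2 := h1.map (shearIteratedEquiv l)
    rwa [map_prod] at h2

/-- The coordinate ring of the curve in the coordinates of `shearIteratedEquiv`. -/
def curveRingEquiv (l : ℂ) (f : MvPolynomial (Fin 2) ℂ) :
    CurveRing f ≃ₐ[ℂ] ℂ⟦X⟧⟦X⟧ ⧸ Ideal.span {shearIteratedEquiv l (toPS f)} :=
  Ideal.quotientEquivAlg _ _ (shearIteratedEquiv l) <| by
    rw [Ideal.map_span, Set.image_singleton]
    rfl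

lemma finite_and_finrank_eq_of_length_add_eq {V W : Type*} [AddCommGroup V] [Module ℂ V]
    [AddCommGroup W] [Module ℂ W] {r : ℕ} (hW : Module.length ℂ W ≠ ⊤)
    (h : Module.length ℂ V + r = 2 • Module.length ℂ W + 1) :
    Module.Finite ℂ V ∧ Module.Finite ℂ W ∧
      (Module.finrank ℂ V : ℤ) = 2 * (Module.finrank ℂ W : ℤ) - (r : ℤ) + 1 := by
  have hV : Module.length ℂ V ≠ ⊤ := by
    intro hV
    obtain ⟨k, hk⟩ := ENat.ne_top_iff_exists.1 hW
    rw [hV, ← hk, top_add, ← Nat.cast_smul_eq_nsmul ℕ∞, smul_eq_mul] at h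
    exact ENat.natCast_ne_top (2 * k + 1) (by push_cast; exact h.symm)
  have hV' : Module.Finite ℂ V := by
    have := (isFiniteLength_iff_isNoetherian_isArtinian.1 (Module.length_ne_top_iff.1 hV)).1
    infer_instance
  have hW' : Module.Finite ℂ W := by
    have := (isFiniteLength_iff_isNoetherian_isArtinian.1 (Module.length_ne_top_iff.1 hW)).1
    infer_instance
  refine ⟨hV', hW', ?_⟩
  rw [Module.length_eq_finrank, Module.length_eq_finrank] at h
  have : Module.finrank ℂ V + r = 2 * Module.finrank ℂ W + 1 := by
    rw [← Nat.cast_smul_eq_nsmul ℕ∞, smul_eq_mul] at h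
    exact_mod_cast h
  omega

end

/-- **Milnor's formula `μ = 2δ - r + 1`.**
Let `f ∈ ℂ[x,y]` be a nonzero polynomial with `f(0,0) = 0` whose image in `R = ℂ⟦x,y⟧` is
squarefree; the latter is recorded by a factorization `f = c·g₁⋯g_r` in `R` with `c` a
unit and the `gᵢ` irreducible and pairwise non-associate, so that `r` is the number of
irreducible factors (branches) of `f` in `R`.  Then the Milnor number
`μ(f) = dim_ℂ R/⟨∂f/∂x, ∂f/∂y⟩` and the delta invariant `δ(f) = dim_ℂ Ō/O` are finite, and
`μ(f) = 2·δ(f) - r + 1`. -/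
theorem milnor_number_eq_two_delta_sub_branches_add_one
    (f : MvPolynomial (Fin 2) ℂ) (hf0 : f ≠ 0)
    (hf00 : MvPolynomial.eval (fun _ => (0 : ℂ)) f = 0)
    (r : ℕ) (g : Fin r → PlanePS)
    (hirr : ∀ i, Irreducible (g i))
    (hdist : ∀ i j, i ≠ j → ¬ Associated (g i) (g j))
    (c : PlanePSˣ) (hfac : toPS f = (c : PlanePS) * ∏ i, g i) :
    Module.Finite ℂ (MilnorAlgebra f) ∧ Module.Finite ℂ (DeltaModule f) ∧
      (Module.finrank ℂ (MilnorAlgebra f) : ℤ) =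
        2 * (Module.finrank ℂ (DeltaModule f) : ℤ) - (r : ℤ) + 1 := by
  have hr : r ≠ 0 := by
    rintro rfl
    have h := constantCoeff_toPS f
    rw [hf00, hfac, Fin.prod_univ_zero, mul_one] at h
    exact (c.isUnit.map MvPowerSeries.constantCoeff).ne_zero h
  obtain ⟨l, B, hc, hB, hF⟩ := exists_puiseuxBranches hf0 hirr hdist hfac
  obtain ⟨φ, hφ, hrange⟩ := PuiseuxBranch.exists_parametrization hc hB hF
  have hnoeth : IsNoetherianRing (CurveRing f) :=
    isNoetherianRing_of_ringEquiv _ (curveRingEquiv l f).symm.toRingEquiv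
  have hdelta : Module.length ℂ (DeltaModule f) = (PuiseuxBranch.powMatrix B).det.order := by
    refine PuiseuxBranch.length_delta (φ.comp (curveRingEquiv l f).toAlgHom)
      (hφ.comp (curveRingEquiv l f).injective) ?_ hB
    rw [← hrange]
    ext y
    constructor
    · rintro ⟨a, rfl⟩
      exact ⟨curveRingEquiv l f a, rfl⟩
    · rintro ⟨a, rfl⟩
      obtain ⟨b, rfl⟩ := (curveRingEquiv l f).surjective a
      exact ⟨b, rfl⟩
  refine finite_and_finrank_eq_of_length_add_eq ?_ ?_
  · rw [hdelta, Ne, PowerSeries.order_eq_top]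
    exact PuiseuxBranch.det_powMatrix_ne_zero hB
  · rw [hdelta, length_milnorAlgebra l]
    exact PuiseuxBranch.milnor_formula hr hc hB hF

end
end
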